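/- Let ρ be a normalized state on registers S, L, E with a purification |ρ⟩⟨ρ| on S, L, E, P. Suppose there exists a δ-quantum state redistribution protocol for ρ in which Alice holds the registers P and L, Bob initially holds E, the reference party holds S, the register to be transmitted is L, and the quantum communication cost is log|Q|. Then for any α ∈ (1,∞): H_α↑,δ(S|LE)_ρ ≥ H_α↑(S|E)_ρ − 2·log|Q|, where H_α↑,δ denotes the δ-smoothed version of H_α↑ (smoothed over subnormalized states within purified distance δ, analogously to the smoothed min-entropy). -/

import Mathlib

open scoped Kronecker
open Matrix
open scoped ComplexOrder

noncomputable section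
namespace QITLeak

variable {A B : Type*}

/-- Real matrix power via spectral decomposition (Moore–Penrose pseudoinverse powers,
since `(0:ℝ) ^ (p:ℝ) = 0` for `p ≠ 0`). Junk value `0` on non-Hermitian input. -/
noncomputable def mpow [Fintype A] [DecidableEq A] (ρ : Matrix A A ℂ) (p : ℝ) :
    Matrix A A ℂ :=
  if hρ : ρ.IsHermitian then
    (hρ.eigenvectorUnitary : Matrix A A ℂ) *
      Matrix.diagonal (fun i => ((hρ.eigenvalues i ^ p : ℝ) : ℂ)) *
      (star (hρ.eigenvectorUnitary : Matrix A A ℂ))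
  else 0

/-- A normalized state (density matrix). -/
def IsState [Fintype A] (ρ : Matrix A A ℂ) : Prop := ρ.PosSemidef ∧ ρ.trace = 1

/-- A subnormalized state. -/
def IsSubState [Fintype A] (ρ : Matrix A A ℂ) : Prop := ρ.PosSemidef ∧ (ρ.trace).re ≤ 1

/-- Partial trace over the second tensor factor. -/
def ptB [Fintype B] (ρ : Matrix (A × B) (A × B) ℂ) : Matrix A A ℂ :=
  Matrix.of fun a a' => ∑ b, ρ (a, b) (a', b)

/-- Partial trace over the first tensor factor. -/
def ptA [Fintype A] (ρ : Matrix (A × B) (A × B) ℂ) : Matrix B B ℂ :=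
  Matrix.of fun b b' => ∑ a, ρ (a, b) (a, b')

/-- Partial trace over the factor `B`, along a decomposition `X ≃ A × B` of the registers. -/
def traceOut {X A B : Type*} [Fintype B] (e : X ≃ A × B) (ρ : Matrix X X ℂ) :
    Matrix A A ℂ :=
  Matrix.of fun a a' => ∑ b, ρ (e.symm (a, b)) (e.symm (a', b))

/-- Support inclusion `supp ρ ⊆ supp σ` (for PSD matrices: kernel inclusion). -/
def suppSubset [Fintype A] (ρ σ : Matrix A A ℂ) : Prop :=
  ∀ v : A → ℂ, σ *ᵥ v = 0 → ρ *ᵥ v = 0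

/-- The real-valued core formula of the sandwiched Rényi divergence (base 2). -/
def DR (α : ℝ) [Fintype A] [DecidableEq A] (ρ σ : Matrix A A ℂ) : ℝ :=
  (α - 1)⁻¹ * Real.logb 2
    (((mpow (mpow σ ((1 - α) / (2 * α)) * ρ * mpow σ ((1 - α) / (2 * α))) α).trace.re)
      / (ρ.trace).re)

open scoped Classical in
/-- The sandwiched Rényi divergence `D_α(ρ‖σ)`, with value `⊤` outside the
support/orthogonality conditions. -/
def D (α : ℝ) [Fintype A] [DecidableEq A] (ρ σ : Matrix A A ℂ) : EReal :=
  if (α < 1 ∧ ¬ (ρ * σ = 0 ∧ σ * ρ = 0)) ∨ suppSubset ρ σ then ((DR α ρ σ : ℝ) : EReal)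
  else ⊤

/-- The max-divergence `D_∞(ρ‖σ)`: log of the least `μ ≥ 0` with `ρ ≤ μσ` (`⊤` if none). -/
def Dmax [Fintype A] (ρ σ : Matrix A A ℂ) : EReal :=
  sInf {x : EReal | ∃ μ : ℝ, 0 ≤ μ ∧ (μ • σ - ρ).PosSemidef ∧ x = ((Real.logb 2 μ : ℝ) : EReal)}

section Ent
variable [Fintype A] [DecidableEq A] [Fintype B] [DecidableEq B]

/-- `H_α↑(A|B)_ρ` for `ρ` on `A × B`. -/
def HUp (α : ℝ) (ρ : Matrix (A × B) (A × B) ℂ) : EReal :=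
  - sInf {x : EReal | ∃ σ : Matrix B B ℂ, IsState σ ∧ x = D α ρ ((1 : Matrix A A ℂ) ⊗ₖ σ)}

/-- `H_α(A|B)_ρ` for `ρ` on `A × B`. -/
def Hdn (α : ℝ) (ρ : Matrix (A × B) (A × B) ℂ) : EReal :=
  - D α ρ ((1 : Matrix A A ℂ) ⊗ₖ ptA ρ)

/-- `I_α↓(A;B)_ρ` for `ρ` on `A × B`. -/
def Idown (α : ℝ) (ρ : Matrix (A × B) (A × B) ℂ) : EReal :=
  sInf {x : EReal | ∃ σ : Matrix B B ℂ, IsState σ ∧ x = D α ρ ((ptB ρ) ⊗ₖ σ)}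

/-- `I_α(A:B)_ρ` for `ρ` on `A × B`. -/
def Imut (α : ℝ) (ρ : Matrix (A × B) (A × B) ℂ) : EReal :=
  D α ρ ((ptB ρ) ⊗ₖ (ptA ρ))

/-- `I_α↓↓(A:B)_ρ` for `ρ` on `A × B`. -/
def Idd (α : ℝ) (ρ : Matrix (A × B) (A × B) ℂ) : EReal :=
  sInf {x : EReal | ∃ (ω : Matrix A A ℂ) (σ : Matrix B B ℂ),
    IsState ω ∧ IsState σ ∧ x = D α ρ (ω ⊗ₖ σ)}

/-- `H_min↑(A|B)_ρ = H_∞↑(A|B)_ρ`. -/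
def HminUp (ρ : Matrix (A × B) (A × B) ℂ) : EReal :=
  - sInf {x : EReal | ∃ σ : Matrix B B ℂ, IsState σ ∧ x = Dmax ρ ((1 : Matrix A A ℂ) ⊗ₖ σ)}

/-- `I_∞↓(A;B)_ρ`. -/
def ImaxD (ρ : Matrix (A × B) (A × B) ℂ) : EReal :=
  sInf {x : EReal | ∃ σ : Matrix B B ℂ, IsState σ ∧ x = Dmax ρ ((ptB ρ) ⊗ₖ σ)}

/-- `I_∞(A:B)_ρ` (unoptimized max-information). -/
def ImaxND (ρ : Matrix (A × B) (A × B) ℂ) : EReal :=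
  Dmax ρ ((ptB ρ) ⊗ₖ (ptA ρ))

/-- `I_∞↓↓(A:B)_ρ`. -/
def IddMax (ρ : Matrix (A × B) (A × B) ℂ) : EReal :=
  sInf {x : EReal | ∃ (ω : Matrix A A ℂ) (σ : Matrix B B ℂ),
    IsState ω ∧ IsState σ ∧ x = Dmax ρ (ω ⊗ₖ σ)}

end Ent

/-- Trace norm. -/
def traceNorm [Fintype A] [DecidableEq A] (M : Matrix A A ℂ) : ℝ :=
  (mpow (Mᴴ * M) (1 / 2 : ℝ)).trace.re

/-- Generalized fidelity of subnormalized states. -/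
def gFid [Fintype A] [DecidableEq A] (ρ σ : Matrix A A ℂ) : ℝ :=
  traceNorm (mpow ρ (1 / 2 : ℝ) * mpow σ (1 / 2 : ℝ)) +
    Real.sqrt ((1 - ρ.trace.re) * (1 - σ.trace.re))

/-- Purified distance. -/
def pDist [Fintype A] [DecidableEq A] (ρ σ : Matrix A A ℂ) : ℝ :=
  Real.sqrt (1 - gFid ρ σ ^ 2)

section Smooth
variable [Fintype A] [DecidableEq A] [Fintype B] [DecidableEq B]

/-- Smoothed min-entropy `H_min↑,ε(A|B)_ρ`. -/
def HminUpEps (ε : ℝ) (ρ : Matrix (A × B) (A × B) ℂ) : EReal :=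
  sSup {x : EReal | ∃ ρ' : Matrix (A × B) (A × B) ℂ,
    IsSubState ρ' ∧ pDist ρ' ρ ≤ ε ∧ x = HminUp ρ'}

/-- Smoothed max-information `I_max↓,ε(A;B)_ρ`. -/
def ImaxDEps (ε : ℝ) (ρ : Matrix (A × B) (A × B) ℂ) : EReal :=
  sInf {x : EReal | ∃ ρ' : Matrix (A × B) (A × B) ℂ,
    IsSubState ρ' ∧ pDist ρ' ρ ≤ ε ∧ x = ImaxD ρ'}

/-- Smoothed (unoptimized) max-information `I_max^ε(A:B)_ρ`. -/
def ImaxNDEps (ε : ℝ) (ρ : Matrix (A × B) (A × B) ℂ) : EReal :=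
  sInf {x : EReal | ∃ ρ' : Matrix (A × B) (A × B) ℂ,
    IsSubState ρ' ∧ pDist ρ' ρ ≤ ε ∧ x = ImaxND ρ'}

/-- Smoothed max-information `I_max↓↓,ε(A:B)_ρ`. -/
def IddMaxEps (ε : ℝ) (ρ : Matrix (A × B) (A × B) ℂ) : EReal :=
  sInf {x : EReal | ∃ ρ' : Matrix (A × B) (A × B) ℂ,
    IsSubState ρ' ∧ pDist ρ' ρ ≤ ε ∧ x = IddMax ρ'}

/-- Smoothed Rényi conditional entropy `H_α↑,ε(A|B)_ρ`. -/
def HUpEps (α ε : ℝ) (ρ : Matrix (A × B) (A × B) ℂ) : EReal :=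
  sSup {x : EReal | ∃ ρ' : Matrix (A × B) (A × B) ℂ,
    IsSubState ρ' ∧ pDist ρ' ρ ≤ ε ∧ x = HUp α ρ'}

end Smooth

/-- Extension `id_R ⊗ Φ` of a linear map on matrices, with a spectator register on the left. -/
def lext {R A B : Type*} (Φ : Matrix A A ℂ →ₗ[ℂ] Matrix B B ℂ) :
    Matrix (R × A) (R × A) ℂ →ₗ[ℂ] Matrix (R × B) (R × B) ℂ where
  toFun ρ := Matrix.of fun p q => Φ (Matrix.of fun a a' => ρ (p.1, a) (q.1, a')) p.2 q.2
  map_add' x y := by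
    ext p q
    show Φ ((Matrix.of fun a a' => x (p.1, a) (q.1, a'))
        + (Matrix.of fun a a' => y (p.1, a) (q.1, a'))) p.2 q.2 = _
    rw [map_add]; rfl
  map_smul' c x := by
    ext p q
    show Φ (c • (Matrix.of fun a a' => x (p.1, a) (q.1, a'))) p.2 q.2 = _
    rw [_root_.map_smul]; rfl

/-- Extension `Φ ⊗ id_R` of a linear map on matrices, with a spectator register on the right. -/
def rext {A B R : Type*} (Φ : Matrix A A ℂ →ₗ[ℂ] Matrix B B ℂ) :
    Matrix (A × R) (A × R) ℂ →ₗ[ℂ] Matrix (B × R) (B × R) ℂ where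
  toFun ρ := Matrix.of fun p q => Φ (Matrix.of fun a a' => ρ (a, p.2) (a', q.2)) p.1 q.1
  map_add' x y := by
    ext p q
    show Φ ((Matrix.of fun a a' => x (a, p.2) (a', q.2))
        + (Matrix.of fun a a' => y (a, p.2) (a', q.2))) p.1 q.1 = _
    rw [map_add]; rfl
  map_smul' c x := by
    ext p q
    show Φ (c • (Matrix.of fun a a' => x (a, p.2) (a', q.2))) p.1 q.1 = _
    rw [_root_.map_smul]; rfl

/-- Completely positive trace-preserving map (quantum channel). -/
structure IsCPTP {A B : Type*} [Fintype A] [Fintype B]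
    (Φ : Matrix A A ℂ →ₗ[ℂ] Matrix B B ℂ) : Prop where
  cp : ∀ (n : ℕ) (ρ : Matrix (Fin n × A) (Fin n × A) ℂ), ρ.PosSemidef →
    ((lext Φ) ρ).PosSemidef
  tp : ∀ ρ : Matrix A A ℂ, (Φ ρ).trace = ρ.trace

/-- The rank-one (pure) state associated to a vector. -/
def pureState {A : Type*} (ψ : A → ℂ) : Matrix A A ℂ := Matrix.vecMulVec ψ (star ψ)


/-! ## Statement 16
Rényi version of the state-redistribution chain rule:
`H_α↑,δ(S|LE)_ρ ≥ H_α↑(S|E)_ρ − 2·log|Q|` for `α ∈ (1,∞)`. -/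

/-- `S × (L × E) ≃ (S × E) × L` (trace out `L`). -/
def eSEL (S L E : Type*) : S × (L × E) ≃ (S × E) × L where
  toFun x := ((x.1, x.2.2), x.2.1)
  invFun y := (y.1.1, (y.2, y.1.2))
  left_inv _ := rfl
  right_inv _ := rfl

/-- Rearrangement for the encoding step. -/
def eEnc (S L E P A' B' : Type*) :
    ((S × (L × E)) × P) × (A' × B') ≃ (S × (E × B')) × ((P × L) × A') where
  toFun x := ((x.1.1.1, (x.1.1.2.2, x.2.2)), ((x.1.2, x.1.1.2.1), x.2.1))
  invFun y := (((y.1.1, (y.2.1.2, y.1.2.1)), y.2.1.1), (y.2.2, y.1.2.2))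
  left_inv _ := rfl
  right_inv _ := rfl

/-- Rearrangement for the decoding step. -/
def eDec (S E P B' Q : Type*) :
    (S × (E × B')) × (P × Q) ≃ (S × P) × ((Q × E) × B') where
  toFun x := ((x.1.1, x.2.1), ((x.2.2, x.1.2.1), x.1.2.2))
  invFun y := ((y.1.1, (y.2.1.2, y.2.2)), (y.1.2, y.2.1.1))
  left_inv _ := rfl
  right_inv _ := rfl

/-- Rearrangement back to the original register ordering. -/
def eFin (S L E P : Type*) : (S × P) × (E × L) ≃ (S × (L × E)) × P where
  toFun x := ((x.1.1, (x.2.2, x.2.1)), x.1.2)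
  invFun y := ((y.1.1, y.2), (y.1.2.2, y.1.2.1))
  left_inv _ := rfl
  right_inv _ := rfl

/-! ### Functional calculus for Hermitian matrices -/

/-- Spectral functional calculus of a Hermitian matrix with complex-valued functions.
Junk value `0` on non-Hermitian input. -/
def mfun {n : Type*} [Fintype n] [DecidableEq n] (M : Matrix n n ℂ) (f : ℝ → ℂ) :
    Matrix n n ℂ :=
  if hM : M.IsHermitian then
    (hM.eigenvectorUnitary : Matrix n n ℂ) * Matrix.diagonal (fun i => f (hM.eigenvalues i)) *
      (star (hM.eigenvectorUnitary : Matrix n n ℂ))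
  else 0

set_option linter.unusedSectionVars false

section Calculus
variable {m n k : Type*} [Fintype m] [DecidableEq m] [Fintype n] [DecidableEq n]
  [Fintype k] [DecidableEq k]

theorem mpow_eq_mfun (M : Matrix n n ℂ) (p : ℝ) :
    mpow M p = mfun M (fun x => ((x ^ p : ℝ) : ℂ)) := rfl

theorem mfun_eq {M : Matrix n n ℂ} (hM : M.IsHermitian) (f : ℝ → ℂ) :
    mfun M f = (hM.eigenvectorUnitary : Matrix n n ℂ) *
      Matrix.diagonal (fun i => f (hM.eigenvalues i)) *
      (hM.eigenvectorUnitary : Matrix n n ℂ)ᴴ := by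
  rw [mfun, dif_pos hM]; rfl

theorem eigenvectorUnitary_conjTranspose_mul {M : Matrix n n ℂ} (hM : M.IsHermitian) :
    (hM.eigenvectorUnitary : Matrix n n ℂ)ᴴ * (hM.eigenvectorUnitary : Matrix n n ℂ) = 1 :=
  Unitary.coe_star_mul_self hM.eigenvectorUnitary

theorem eigenvectorUnitary_mul_conjTranspose {M : Matrix n n ℂ} (hM : M.IsHermitian) :
    (hM.eigenvectorUnitary : Matrix n n ℂ) * (hM.eigenvectorUnitary : Matrix n n ℂ)ᴴ = 1 :=
  Unitary.coe_mul_star_self hM.eigenvectorUnitary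

theorem mfun_id {M : Matrix n n ℂ} (hM : M.IsHermitian) : mfun M (fun x => (x : ℂ)) = M := by
  rw [mfun_eq hM]
  conv_rhs => rw [hM.spectral_theorem, Unitary.conjStarAlgAut_apply]
  rfl

theorem mul_eigenvectorUnitary {M : Matrix n n ℂ} (hM : M.IsHermitian) :
    M * (hM.eigenvectorUnitary : Matrix n n ℂ) =
      (hM.eigenvectorUnitary : Matrix n n ℂ) *
        Matrix.diagonal (fun i => (hM.eigenvalues i : ℂ)) := by
  conv_lhs => arg 1; rw [← mfun_id hM, mfun_eq hM]
  rw [Matrix.mul_assoc, eigenvectorUnitary_conjTranspose_mul, Matrix.mul_one]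

theorem mfun_mul_eigenvectorUnitary {M : Matrix n n ℂ} (hM : M.IsHermitian) (f : ℝ → ℂ) :
    mfun M f * (hM.eigenvectorUnitary : Matrix n n ℂ) =
      (hM.eigenvectorUnitary : Matrix n n ℂ) *
        Matrix.diagonal (fun i => f (hM.eigenvalues i)) := by
  rw [mfun_eq hM, Matrix.mul_assoc, eigenvectorUnitary_conjTranspose_mul, Matrix.mul_one]

theorem eq_of_mul_eigenvectorUnitary {M : Matrix n n ℂ} (hM : M.IsHermitian)
    {X Y : Matrix m n ℂ} (h : X * (hM.eigenvectorUnitary : Matrix n n ℂ) =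
      Y * (hM.eigenvectorUnitary : Matrix n n ℂ)) : X = Y := by
  have := congrArg (· * (hM.eigenvectorUnitary : Matrix n n ℂ)ᴴ) h
  simpa only [Matrix.mul_assoc, eigenvectorUnitary_mul_conjTranspose, Matrix.mul_one] using this

/-- A matrix whose columns are eigenvectors of `M` also diagonalizes every function of `M`. -/
theorem mfun_mul_of_mul_diagonal {M : Matrix n n ℂ} (hM : M.IsHermitian) {W : Matrix n k ℂ}
    {d : k → ℝ} (h : M * W = W * Matrix.diagonal (fun i => (d i : ℂ))) (f : ℝ → ℂ) :
    mfun M f * W = W * Matrix.diagonal (fun i => f (d i)) := by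
  set U : Matrix n n ℂ := (hM.eigenvectorUnitary : Matrix n n ℂ) with hU
  have h1 : Matrix.diagonal (fun i => (hM.eigenvalues i : ℂ)) * (Uᴴ * W) =
      (Uᴴ * W) * Matrix.diagonal (fun i => (d i : ℂ)) := by
    rw [Matrix.mul_assoc Uᴴ W, ← h]
    conv_rhs => arg 2; arg 1; rw [← mfun_id hM, mfun_eq hM, ← hU]
    simp only [Matrix.mul_assoc]
    rw [← Matrix.mul_assoc Uᴴ U, hU, eigenvectorUnitary_conjTranspose_mul, Matrix.one_mul]
  have h2 : Matrix.diagonal (fun i => f (hM.eigenvalues i)) * (Uᴴ * W) =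
      (Uᴴ * W) * Matrix.diagonal (fun i => f (d i)) := by
    ext i j
    have := congrFun (congrFun h1 i) j
    rw [Matrix.diagonal_mul, Matrix.mul_diagonal, mul_comm] at this ⊢
    by_cases h0 : (Uᴴ * W) i j = 0
    · rw [h0]; simp
    · have := mul_left_cancel₀ h0 this
      rw [Complex.ofReal_inj.1 this]
  rw [mfun_eq hM, ← hU, Matrix.mul_assoc, Matrix.mul_assoc, h2, ← Matrix.mul_assoc,
    ← Matrix.mul_assoc, hU, eigenvectorUnitary_mul_conjTranspose, Matrix.one_mul]

theorem mfun_congr {M : Matrix n n ℂ} (hM : M.PosSemidef) {f g : ℝ → ℂ}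
    (h : ∀ x, 0 ≤ x → f x = g x) : mfun M f = mfun M g := by
  rw [mfun_eq hM.1, mfun_eq hM.1]
  congr 3
  funext i
  exact h _ (hM.eigenvalues_nonneg i)

theorem mfun_mul {M : Matrix n n ℂ} (hM : M.IsHermitian) (f g : ℝ → ℂ) :
    mfun M f * mfun M g = mfun M (fun x => f x * g x) := by
  apply eq_of_mul_eigenvectorUnitary hM
  rw [Matrix.mul_assoc, mfun_mul_eigenvectorUnitary, ← Matrix.mul_assoc,
    mfun_mul_eigenvectorUnitary, Matrix.mul_assoc, Matrix.diagonal_mul_diagonal,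
    mfun_mul_eigenvectorUnitary]

theorem mfun_one {M : Matrix n n ℂ} (hM : M.IsHermitian) : mfun M (fun _ => 1) = 1 := by
  apply eq_of_mul_eigenvectorUnitary hM
  rw [mfun_mul_eigenvectorUnitary]; simp

theorem mfun_sub {M : Matrix n n ℂ} (hM : M.IsHermitian) (f g : ℝ → ℂ) :
    mfun M f - mfun M g = mfun M (fun x => f x - g x) := by
  apply eq_of_mul_eigenvectorUnitary hM
  rw [Matrix.sub_mul, mfun_mul_eigenvectorUnitary, mfun_mul_eigenvectorUnitary,
    mfun_mul_eigenvectorUnitary, ← Matrix.mul_sub, Matrix.diagonal_sub]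

theorem mfun_const_mul {M : Matrix n n ℂ} (hM : M.IsHermitian) (c : ℂ) (f : ℝ → ℂ) :
    mfun M (fun x => c * f x) = c • mfun M f := by
  apply eq_of_mul_eigenvectorUnitary hM
  rw [Matrix.smul_mul, mfun_mul_eigenvectorUnitary, mfun_mul_eigenvectorUnitary,
    ← Matrix.mul_smul]
  congr 1
  ext i j
  by_cases h : i = j <;> simp [Matrix.diagonal, h]

theorem mfun_conjTranspose (M : Matrix n n ℂ) (f : ℝ → ℂ) :
    (mfun M f)ᴴ = mfun M (fun x => star (f x)) := by
  by_cases hM : M.IsHermitian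
  · rw [mfun_eq hM, mfun_eq hM]
    simp only [Matrix.conjTranspose_mul, Matrix.conjTranspose_conjTranspose,
      Matrix.diagonal_conjTranspose, Matrix.mul_assoc]
    rfl
  · simp [mfun, hM]

theorem mfun_isHermitian (M : Matrix n n ℂ) (f : ℝ → ℝ) :
    (mfun M (fun x => (f x : ℂ))).IsHermitian := by
  rw [Matrix.IsHermitian, mfun_conjTranspose]
  simp

theorem mfun_posSemidef {M : Matrix n n ℂ} (hM : M.PosSemidef) {f : ℝ → ℂ}
    (hf : ∀ x, 0 ≤ x → 0 ≤ f x) : (mfun M f).PosSemidef := by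
  rw [mfun_eq hM.1]
  apply Matrix.PosSemidef.mul_mul_conjTranspose_same
  apply Matrix.PosSemidef.diagonal
  intro i
  exact hf _ (hM.eigenvalues_nonneg i)

theorem mfun_comp {M : Matrix n n ℂ} (hM : M.IsHermitian) (g : ℝ → ℝ) (f : ℝ → ℂ) :
    mfun (mfun M (fun x => (g x : ℂ))) f = mfun M (fun x => f (g x)) := by
  apply eq_of_mul_eigenvectorUnitary hM
  rw [mfun_mul_eigenvectorUnitary]
  exact mfun_mul_of_mul_diagonal (mfun_isHermitian M g)
    (mfun_mul_eigenvectorUnitary hM (fun x => (g x : ℂ))) f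

theorem mfun_smul {M : Matrix n n ℂ} (hM : M.IsHermitian) (c : ℝ) (f : ℝ → ℂ) :
    mfun ((c : ℂ) • M) f = mfun M (fun x => f (c * x)) := by
  conv_lhs => rw [← mfun_id hM, ← mfun_const_mul hM]
  have := mfun_comp hM (fun x => c * x) f
  simpa using this

theorem trace_mfun {M : Matrix n n ℂ} (hM : M.IsHermitian) (f : ℝ → ℂ) :
    (mfun M f).trace = ∑ i, f (hM.eigenvalues i) := by
  rw [mfun_eq hM, Matrix.trace_mul_comm, ← Matrix.mul_assoc,
    eigenvectorUnitary_conjTranspose_mul, Matrix.one_mul, Matrix.trace_diagonal]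

/-! ### Real powers -/

theorem mpow_posSemidef {M : Matrix n n ℂ} (hM : M.PosSemidef) (p : ℝ) :
    (mpow M p).PosSemidef := by
  rw [mpow_eq_mfun]
  exact mfun_posSemidef hM fun x hx => by exact_mod_cast Real.rpow_nonneg hx p

theorem mpow_conjTranspose (M : Matrix n n ℂ) (p : ℝ) : (mpow M p)ᴴ = mpow M p := by
  rw [mpow_eq_mfun]
  exact mfun_isHermitian M (fun x => x ^ p)

theorem mpow_mul_mpow {M : Matrix n n ℂ} (hM : M.PosSemidef) {p q : ℝ} (h : p + q ≠ 0) :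
    mpow M p * mpow M q = mpow M (p + q) := by
  rw [mpow_eq_mfun, mpow_eq_mfun, mpow_eq_mfun, mfun_mul hM.1]
  apply mfun_congr hM
  intro x hx
  rw [← Complex.ofReal_mul, ← Real.rpow_add' hx h]

theorem mpow_one {M : Matrix n n ℂ} (hM : M.IsHermitian) : mpow M 1 = M := by
  rw [mpow_eq_mfun]
  simpa using mfun_id hM

theorem mpow_mpow {M : Matrix n n ℂ} (hM : M.PosSemidef) (p q : ℝ) :
    mpow (mpow M p) q = mpow M (p * q) := by
  rw [mpow_eq_mfun, mpow_eq_mfun, mpow_eq_mfun, mfun_comp hM.1 (fun x => x ^ p)]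
  apply mfun_congr hM
  intro x hx
  rw [Real.rpow_mul hx]

theorem mpow_smul {M : Matrix n n ℂ} (hM : M.PosSemidef) {c : ℝ} (hc : 0 ≤ c) (p : ℝ) :
    mpow ((c : ℂ) • M) p = ((c ^ p : ℝ) : ℂ) • mpow M p := by
  rw [mpow_eq_mfun, mpow_eq_mfun, mfun_smul hM.1, ← mfun_const_mul hM.1]
  apply mfun_congr hM
  intro x hx
  rw [Real.mul_rpow hc hx, Complex.ofReal_mul]

/-- The support projection of a positive semidefinite matrix. -/
def suppProj (M : Matrix n n ℂ) : Matrix n n ℂ := mfun M (fun x => if x = 0 then 0 else 1)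

theorem suppProj_conjTranspose (M : Matrix n n ℂ) : (suppProj M)ᴴ = suppProj M := by
  rw [suppProj, mfun_conjTranspose]
  congr 1
  funext x
  split_ifs <;> simp

theorem mpow_mul_mpow_neg {M : Matrix n n ℂ} (hM : M.PosSemidef) {p : ℝ} (h : p ≠ 0) :
    mpow M p * mpow M (-p) = suppProj M := by
  rw [mpow_eq_mfun, mpow_eq_mfun, suppProj, mfun_mul hM.1]
  apply mfun_congr hM
  intro x hx
  split_ifs with h0
  · simp [h0, Real.zero_rpow h]
  · rw [← Complex.ofReal_mul, ← Real.rpow_add (lt_of_le_of_ne hx (Ne.symm h0))]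
    simp

theorem mpow_neg_mul_mpow {M : Matrix n n ℂ} (hM : M.PosSemidef) {p : ℝ} (h : p ≠ 0) :
    mpow M (-p) * mpow M p = suppProj M := by
  have := mpow_mul_mpow_neg hM (p := -p) (neg_ne_zero.2 h)
  rwa [neg_neg] at this

theorem one_sub_suppProj_posSemidef {M : Matrix n n ℂ} (hM : M.PosSemidef) :
    (1 - suppProj M).PosSemidef := by
  rw [suppProj, ← mfun_one hM.1, mfun_sub hM.1]
  apply mfun_posSemidef hM
  intro x _
  split_ifs <;> simp

theorem mul_one_sub_suppProj {M : Matrix n n ℂ} (hM : M.PosSemidef) :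
    M * (1 - suppProj M) = 0 := by
  rw [suppProj, ← mfun_one hM.1, mfun_sub hM.1]
  conv_lhs => rw [← mfun_id hM.1]
  rw [mfun_id hM.1]
  conv_lhs => arg 1; rw [← mfun_id hM.1]
  rw [mfun_mul hM.1, ← zero_smul ℂ (mfun M fun _ => 1), ← mfun_const_mul hM.1]
  congr 1
  funext x
  split_ifs with h <;> simp [h]

theorem mul_suppProj_of_suppSubset {R M : Matrix n n ℂ} (hM : M.PosSemidef)
    (h : suppSubset R M) : R * suppProj M = R := by
  have h0 : R * (1 - suppProj M) = 0 := by
    ext i j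
    have h1 : M *ᵥ (fun a => (1 - suppProj M) a j) = 0 := by
      funext a
      exact congrFun (congrFun (mul_one_sub_suppProj hM) a) j
    exact congrFun (h _ h1) i
  rw [Matrix.mul_sub, Matrix.mul_one, sub_eq_zero] at h0
  exact h0.symm

theorem suppSubset_of_le {R M : Matrix n n ℂ} (hR : R.PosSemidef) {c : ℝ}
    (h : ((c : ℂ) • M - R).PosSemidef) : suppSubset R M := by
  intro v hv
  have h1 := h.dotProduct_mulVec_nonneg v
  have h2 := hR.dotProduct_mulVec_nonneg v
  rw [Matrix.sub_mulVec, Matrix.smul_mulVec, hv] at h1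
  simp only [smul_zero, zero_sub, dotProduct_neg, Left.nonneg_neg_iff] at h1
  exact (hR.dotProduct_mulVec_zero_iff v).1 (le_antisymm h1 h2)

theorem suppProj_mul_mul_suppProj {R M : Matrix n n ℂ} (hR : R.IsHermitian) (hM : M.PosSemidef)
    (h : suppSubset R M) : suppProj M * R * suppProj M = R := by
  have h1 := mul_suppProj_of_suppSubset hM h
  have h2 := congrArg Matrix.conjTranspose h1
  rw [Matrix.conjTranspose_mul, suppProj_conjTranspose, hR] at h2
  rw [h2, h1]

theorem mpow_conj_cancel {R M : Matrix n n ℂ} (hR : R.IsHermitian) (hM : M.PosSemidef)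
    (h : suppSubset R M) {p : ℝ} (hp : p ≠ 0) :
    mpow M (-p) * (mpow M p * R * mpow M p) * mpow M (-p) = R := by
  calc _ = (mpow M (-p) * mpow M p) * R * (mpow M p * mpow M (-p)) := by
        simp only [Matrix.mul_assoc]
    _ = R := by
        rw [mpow_neg_mul_mpow hM hp, mpow_mul_mpow_neg hM hp, suppProj_mul_mul_suppProj hR hM h]

theorem mpow_conj_posSemidef {R M : Matrix n n ℂ} (hR : R.PosSemidef) (p : ℝ) :
    (mpow M p * R * mpow M p).PosSemidef := by
  have := hR.mul_mul_conjTranspose_same (mpow M p)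
  rwa [mpow_conjTranspose] at this

/-- A positive semidefinite matrix is dominated by its trace times the identity. -/
theorem trace_smul_one_sub_posSemidef {M : Matrix n n ℂ} (hM : M.PosSemidef) :
    (((M.trace.re : ℝ) : ℂ) • (1 : Matrix n n ℂ) - M).PosSemidef := by
  have ht : M.trace.re = ∑ i, hM.1.eigenvalues i := by
    conv_lhs => rw [← mfun_id hM.1, trace_mfun hM.1]
    simp
  rw [ht]
  have : ((∑ i, hM.1.eigenvalues i : ℝ) : ℂ) • (1 : Matrix n n ℂ) - M =
      mfun M (fun x => ((∑ i, hM.1.eigenvalues i : ℝ) : ℂ) * 1 - x) := by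
    rw [← mfun_sub hM.1, mfun_const_mul hM.1, mfun_one hM.1, mfun_id hM.1]
  rw [this, mfun_eq hM.1]
  apply Matrix.PosSemidef.mul_mul_conjTranspose_same
  apply Matrix.PosSemidef.diagonal
  intro i
  show (0 : ℂ) ≤ ((∑ i, hM.1.eigenvalues i : ℝ) : ℂ) * 1 - (hM.1.eigenvalues i : ℂ)
  rw [mul_one, ← Complex.ofReal_sub, Complex.zero_le_real, sub_nonneg]
  exact Finset.single_le_sum (f := hM.1.eigenvalues) (fun j _ => hM.eigenvalues_nonneg j)
    (Finset.mem_univ i)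

theorem exists_le_of_suppSubset {R M : Matrix n n ℂ} (hR : R.PosSemidef) (hM : M.PosSemidef)
    (h : suppSubset R M) : ∃ c : ℝ, 0 ≤ c ∧ ((c : ℂ) • M - R).PosSemidef := by
  set Z := mpow M (-(1 / 2)) * R * mpow M (-(1 / 2)) with hZ
  have hZp : Z.PosSemidef := mpow_conj_posSemidef hR _
  refine ⟨Z.trace.re, (Complex.le_def.1 hZp.trace_nonneg).1, ?_⟩
  have h1 := (trace_smul_one_sub_posSemidef hZp).mul_mul_conjTranspose_same (mpow M (1 / 2))
  have h2 := mpow_conj_cancel hR.1 hM h (p := -(1 / 2)) (by norm_num)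
  rw [neg_neg] at h2
  rw [mpow_conjTranspose, Matrix.mul_sub, Matrix.sub_mul, hZ, h2, ← hZ, Matrix.mul_smul,
    Matrix.mul_one, Matrix.smul_mul, mpow_mul_mpow hM (by norm_num)] at h1
  norm_num at h1
  rwa [mpow_one hM.1] at h1

end Calculus

/-! ### Hilbert–Schmidt norms and contractions -/

/-- Squared Hilbert–Schmidt norm. -/
def hs {m n : Type*} [Fintype m] [Fintype n] (M : Matrix m n ℂ) : ℝ := ∑ i, ∑ j, ‖M i j‖ ^ 2

section HilbertSchmidt
variable {m n k : Type*} [Fintype m] [DecidableEq m] [Fintype n] [DecidableEq n]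
  [Fintype k] [DecidableEq k]

theorem hs_nonneg (M : Matrix m n ℂ) : 0 ≤ hs M :=
  Finset.sum_nonneg fun _ _ => Finset.sum_nonneg fun _ _ => by positivity

theorem trace_conjTranspose_mul_self (M : Matrix m n ℂ) : (Mᴴ * M).trace = (hs M : ℂ) := by
  simp only [Matrix.trace, Matrix.diag, Matrix.mul_apply, Matrix.conjTranspose_apply, hs,
    Complex.ofReal_sum]
  rw [Finset.sum_comm]
  refine Finset.sum_congr rfl fun i _ => Finset.sum_congr rfl fun j _ => ?_
  rw [Complex.star_def, Complex.conj_mul', Complex.ofReal_pow]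

theorem trace_mul_conjTranspose_self (M : Matrix m n ℂ) : (M * Mᴴ).trace = (hs M : ℂ) := by
  rw [Matrix.trace_mul_comm, trace_conjTranspose_mul_self]

theorem hs_contraction_mul {C : Matrix m m ℂ} (hC : (1 - Cᴴ * C).PosSemidef)
    (M : Matrix m n ℂ) : hs (C * M) ≤ hs M := by
  have h := (hC.conjTranspose_mul_mul_same M).trace_nonneg
  have e : Mᴴ * (1 - Cᴴ * C) * M = Mᴴ * M - (C * M)ᴴ * (C * M) := by
    simp only [Matrix.mul_sub, Matrix.sub_mul, Matrix.mul_one, Matrix.conjTranspose_mul,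
      Matrix.mul_assoc]
  rw [e, Matrix.trace_sub, trace_conjTranspose_mul_self, trace_conjTranspose_mul_self,
    ← Complex.ofReal_sub, Complex.zero_le_real] at h
  linarith

theorem hs_mul_contraction {C : Matrix n n ℂ} (hC : (1 - C * Cᴴ).PosSemidef)
    (M : Matrix m n ℂ) : hs (M * C) ≤ hs M := by
  have h := (hC.mul_mul_conjTranspose_same M).trace_nonneg
  have e : M * (1 - C * Cᴴ) * Mᴴ = M * Mᴴ - (M * C) * (M * C)ᴴ := by
    simp only [Matrix.mul_sub, Matrix.sub_mul, Matrix.mul_one, Matrix.conjTranspose_mul,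
      Matrix.mul_assoc]
  rw [e, Matrix.trace_sub, trace_mul_conjTranspose_self, trace_mul_conjTranspose_self,
    ← Complex.ofReal_sub, Complex.zero_le_real] at h
  linarith

/-- Complex powers of a nonnegative real number, with the support convention `0 ^ z = 0`. -/
def cpw (z : ℂ) (x : ℝ) : ℂ := if x = 0 then 0 else (x : ℂ) ^ z

theorem cpw_add (z w : ℂ) (x : ℝ) : cpw (z + w) x = cpw z x * cpw w x := by
  unfold cpw
  split_ifs with h
  · simp
  · exact Complex.cpow_add _ _ (by exact_mod_cast h)

theorem cpw_ofReal {s : ℝ} (hs : s ≠ 0) {x : ℝ} (hx : 0 ≤ x) :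
    cpw s x = ((x ^ s : ℝ) : ℂ) := by
  unfold cpw
  split_ifs with h
  · simp [h, Real.zero_rpow hs]
  · rw [Complex.ofReal_cpow hx]

theorem norm_cpw {z : ℂ} {x : ℝ} (hx : 0 < x) : ‖cpw z x‖ = x ^ z.re := by
  rw [cpw, if_neg hx.ne', Complex.norm_cpow_eq_rpow_re_of_pos hx]

/-- Complex powers of a positive semidefinite matrix, taken on its support. -/
def cmpow (M : Matrix n n ℂ) (z : ℂ) : Matrix n n ℂ := mfun M (cpw z)

theorem cmpow_add {M : Matrix n n ℂ} (hM : M.PosSemidef) (z w : ℂ) :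
    cmpow M (z + w) = cmpow M z * cmpow M w := by
  rw [cmpow, cmpow, cmpow, mfun_mul hM.1]
  congr 1
  funext x
  exact cpw_add z w x

theorem cmpow_ofReal {M : Matrix n n ℂ} (hM : M.PosSemidef) {s : ℝ} (h : s ≠ 0) :
    cmpow M (s : ℂ) = mpow M s := by
  rw [cmpow, mpow_eq_mfun]
  exact mfun_congr hM fun x hx => cpw_ofReal h hx

theorem one_sub_star_mul_nonneg {z : ℂ} {x : ℝ} (hz : z.re = 0) (hx : 0 ≤ x) :
    0 ≤ 1 - star (cpw z x) * cpw z x := by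
  rw [Complex.star_def, Complex.conj_mul']
  have : ‖cpw z x‖ ≤ 1 := by
    rcases hx.eq_or_lt with rfl | hx
    · simp [cpw]
    · rw [norm_cpw hx, hz, Real.rpow_zero]
  have h2 : ‖cpw z x‖ ^ 2 ≤ 1 := pow_le_one₀ (norm_nonneg _) this
  rw [← Complex.ofReal_pow, ← Complex.ofReal_one, ← Complex.ofReal_sub, Complex.zero_le_real]
  linarith

theorem cmpow_contraction {M : Matrix n n ℂ} (hM : M.PosSemidef) {z : ℂ} (hz : z.re = 0) :
    (1 - (cmpow M z)ᴴ * cmpow M z).PosSemidef := by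
  rw [cmpow, mfun_conjTranspose, mfun_mul hM.1, ← mfun_one hM.1, mfun_sub hM.1]
  exact mfun_posSemidef hM fun x hx => one_sub_star_mul_nonneg hz hx

theorem cmpow_contraction' {M : Matrix n n ℂ} (hM : M.PosSemidef) {z : ℂ} (hz : z.re = 0) :
    (1 - cmpow M z * (cmpow M z)ᴴ).PosSemidef := by
  rw [cmpow, mfun_conjTranspose, mfun_mul hM.1, ← mfun_one hM.1, mfun_sub hM.1]
  refine mfun_posSemidef hM fun x hx => ?_
  rw [mul_comm]
  exact one_sub_star_mul_nonneg hz hx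

end HilbertSchmidt

/-! ### The three lines theorem in Hilbert–Schmidt norm -/

/-- Entire functions that are bounded on the closed strip `0 ≤ re z ≤ 1`. -/
def StripBounded (f : ℂ → ℂ) : Prop :=
  Differentiable ℂ f ∧ ∃ C : ℝ, ∀ z : ℂ, 0 ≤ z.re → z.re ≤ 1 → ‖f z‖ ≤ C

theorem StripBounded.const (c : ℂ) : StripBounded fun _ => c :=
  ⟨differentiable_const c, ‖c‖, fun _ _ _ => le_rfl⟩

theorem StripBounded.mul {f g : ℂ → ℂ} (hf : StripBounded f) (hg : StripBounded g) :
    StripBounded fun z => f z * g z := by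
  obtain ⟨hf, C, hC⟩ := hf
  obtain ⟨hg, D, hD⟩ := hg
  refine ⟨hf.mul hg, C * D, fun z h0 h1 => ?_⟩
  rw [norm_mul]
  exact mul_le_mul (hC z h0 h1) (hD z h0 h1) (norm_nonneg _)
    ((norm_nonneg _).trans (hC z h0 h1))

theorem StripBounded.sum {ι : Type*} {s : Finset ι} {f : ι → ℂ → ℂ}
    (hf : ∀ i, StripBounded (f i)) : StripBounded fun z => ∑ i ∈ s, f i z := by
  choose hd C hC using hf
  refine ⟨Differentiable.fun_sum fun i _ => hd i, ∑ i ∈ s, C i, fun z h0 h1 => ?_⟩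
  exact (norm_sum_le _ _).trans (Finset.sum_le_sum fun i _ => hC i z h0 h1)

theorem stripBounded_cpw (a b : ℝ) {x : ℝ} (hx : 0 ≤ x) :
    StripBounded fun z => cpw ((a : ℂ) * z + b) x := by
  rcases hx.eq_or_lt with rfl | hx
  · simpa [cpw] using StripBounded.const 0
  have hx' : (x : ℂ) ≠ 0 := by exact_mod_cast hx.ne'
  refine ⟨?_, Real.exp (|Real.log x| * (|a| + |b|)), fun z h0 h1 => ?_⟩
  · simp only [cpw, if_neg hx.ne']
    have : Differentiable ℂ fun z : ℂ => (a : ℂ) * z + b := by fun_prop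
    exact this.const_cpow (Or.inl hx')
  · rw [norm_cpw hx, Real.rpow_def_of_pos hx]
    apply Real.exp_le_exp.2
    have h : |a * z.re + b| ≤ |a| + |b| := by
      refine (abs_add_le _ _).trans (add_le_add_left ?_ _)
      rw [abs_mul, abs_of_nonneg h0]
      exact mul_le_of_le_one_right (abs_nonneg _) h1
    have e : ((a : ℂ) * z + b).re = a * z.re + b := by simp
    rw [e]
    refine (le_abs_self _).trans ?_
    rw [abs_mul]
    exact mul_le_mul_of_nonneg_left h (abs_nonneg _)

section ThreeLines
variable {m n k : Type*} [Fintype m] [DecidableEq m] [Fintype n] [DecidableEq n]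
  [Fintype k] [DecidableEq k]

/-- Matrix-valued functions all of whose entries are `StripBounded`. -/
def StripBoundedMat (F : ℂ → Matrix m n ℂ) : Prop := ∀ i j, StripBounded fun z => F z i j

theorem StripBoundedMat.const (M : Matrix m n ℂ) : StripBoundedMat fun _ => M :=
  fun i j => StripBounded.const (M i j)

theorem StripBoundedMat.mul {F : ℂ → Matrix m n ℂ} {G : ℂ → Matrix n k ℂ}
    (hF : StripBoundedMat F) (hG : StripBoundedMat G) : StripBoundedMat fun z => F z * G z := by
  intro i j
  simp only [Matrix.mul_apply]
  exact StripBounded.sum fun l => (hF i l).mul (hG l j)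

theorem stripBoundedMat_cmpow {M : Matrix n n ℂ} (hM : M.PosSemidef) {w : ℂ → ℂ} (a b : ℝ)
    (hw : ∀ z, w z = (a : ℂ) * z + b) : StripBoundedMat fun z => cmpow M (w z) := by
  have hdiag : StripBoundedMat fun z =>
      Matrix.diagonal fun i => cpw (w z) (hM.1.eigenvalues i) := by
    intro i j
    by_cases hij : i = j
    · subst hij
      simpa only [Matrix.diagonal_apply_eq, hw] using
        stripBounded_cpw a b (hM.eigenvalues_nonneg i)
    · simpa only [Matrix.diagonal_apply_ne _ hij] using StripBounded.const 0
  simp only [cmpow, mfun_eq hM.1]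
  exact ((StripBoundedMat.const _).mul hdiag).mul (StripBoundedMat.const _)

theorem norm_sum_star_mul_le {ι : Type*} [Fintype ι] (f g : ι → ℂ) :
    ‖∑ i, star (f i) * g i‖ ≤ √(∑ i, ‖f i‖ ^ 2) * √(∑ i, ‖g i‖ ^ 2) := by
  refine (norm_sum_le _ _).trans ?_
  simp only [norm_mul, norm_star]
  exact Real.sum_mul_le_sqrt_mul_sqrt _ _ _

/-- Hadamard's three lines theorem for families of matrices in Hilbert–Schmidt norm. -/
theorem sum_hs_le_interp {ι : Type*} [Fintype ι] {F : ι → ℂ → Matrix m n ℂ}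
    (hF : ∀ i, StripBoundedMat (F i)) {u v : ℝ} (hu : 0 ≤ u) (hv : 0 ≤ v)
    (h0 : ∀ z : ℂ, z.re = 0 → ∑ i, hs (F i z) ≤ u)
    (h1 : ∀ z : ℂ, z.re = 1 → ∑ i, hs (F i z) ≤ v)
    {θ : ℝ} (hθ0 : 0 ≤ θ) (hθ1 : θ ≤ 1) :
    ∑ i, hs (F i θ) ≤ u ^ (1 - θ) * v ^ θ := by
  have e : ∀ z, ∑ i, hs (F i z) = ∑ x : ι × m × n, ‖F x.1 z x.2.1 x.2.2‖ ^ 2 := by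
    intro z
    simp only [Fintype.sum_prod_type, hs]
  set t := ∑ i, hs (F i θ) with ht
  have ht0 : 0 ≤ t := Finset.sum_nonneg fun i _ => hs_nonneg _
  set f : ℂ → ℂ := fun z =>
    ∑ x : ι × m × n, star (F x.1 θ x.2.1 x.2.2) * F x.1 z x.2.1 x.2.2 with hf
  have hfS : StripBounded f := StripBounded.sum fun x =>
    (StripBounded.const _).mul (hF x.1 x.2.1 x.2.2)
  have hfb : ∀ z, ‖f z‖ ≤ √t * √(∑ i, hs (F i z)) := by
    intro z
    rw [ht, e, e]
    exact norm_sum_star_mul_le _ _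
  have hfθ : ‖f θ‖ = t := by
    have : f θ = (t : ℂ) := by
      rw [ht, e, Complex.ofReal_sum, hf]
      refine Finset.sum_congr rfl fun x _ => ?_
      rw [Complex.star_def, Complex.conj_mul', Complex.ofReal_pow]
    rw [this, Complex.norm_real, Real.norm_of_nonneg ht0]
  obtain ⟨hd, C, hC⟩ := hfS
  have key := Complex.HadamardThreeLines.norm_le_interp_of_mem_verticalClosedStrip₀₁' f
    (z := (θ : ℂ)) (a := √t * √u) (b := √t * √v)
    (by simp [Complex.HadamardThreeLines.verticalClosedStrip, hθ0, hθ1])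
    hd.diffContOnCl
    ⟨C, by
      rintro _ ⟨z, hz, rfl⟩
      exact hC z hz.1 hz.2⟩
    (fun z hz => (hfb z).trans
      (mul_le_mul_of_nonneg_left (Real.sqrt_le_sqrt (h0 z hz)) (Real.sqrt_nonneg _)))
    (fun z hz => (hfb z).trans
      (mul_le_mul_of_nonneg_left (Real.sqrt_le_sqrt (h1 z hz)) (Real.sqrt_nonneg _)))
  rw [hfθ, Complex.ofReal_re, Real.mul_rpow (Real.sqrt_nonneg _) (Real.sqrt_nonneg _),
    Real.mul_rpow (Real.sqrt_nonneg _) (Real.sqrt_nonneg _)] at key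
  have e1 : √t ^ (1 - θ) * √u ^ (1 - θ) * (√t ^ θ * √v ^ θ) =
      √t * √(u ^ (1 - θ) * v ^ θ) := by
    have : √t ^ (1 - θ) * √t ^ θ = √t := by
      rw [← Real.rpow_add' (Real.sqrt_nonneg _) (by simp)]
      simp
    rw [Real.sqrt_mul (by positivity), Real.sqrt_eq_rpow (u ^ (1 - θ)), ← Real.rpow_mul hu,
      Real.sqrt_eq_rpow (v ^ θ), ← Real.rpow_mul hv, mul_comm (1 - θ), mul_comm θ,
      Real.rpow_mul hu, Real.rpow_mul hv, ← Real.sqrt_eq_rpow, ← Real.sqrt_eq_rpow]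
    calc _ = (√t ^ (1 - θ) * √t ^ θ) * (√u ^ (1 - θ) * √v ^ θ) := by ring
      _ = _ := by rw [this]
  rw [e1] at key
  rcases ht0.eq_or_lt with h | h
  · rw [← h]; positivity
  · have hs := Real.sqrt_pos.2 h
    have : √t ≤ √(u ^ (1 - θ) * v ^ θ) := by
      have h2 : √t * √t ≤ √t * √(u ^ (1 - θ) * v ^ θ) := by rwa [Real.mul_self_sqrt ht0]
      exact le_of_mul_le_mul_left h2 hs
    exact (Real.sqrt_le_sqrt_iff (by positivity)).1 this

end ThreeLines

/-! ### Data processing for the sandwiched Rényi divergence -/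

/-- The completely positive map with Kraus operators `K`. -/
def kmap {ι m n : Type*} [Fintype ι] [Fintype m] (K : ι → Matrix n m ℂ) (X : Matrix m m ℂ) :
    Matrix n n ℂ := ∑ i, K i * X * (K i)ᴴ

/-- The trace functional `Tr[(σ^{(1-α)/(2α)} ρ σ^{(1-α)/(2α)})^α]`. -/
def renyiQ {n : Type*} [Fintype n] [DecidableEq n] (α : ℝ) (ρ σ : Matrix n n ℂ) : ℝ :=
  (mpow (mpow σ ((1 - α) / (2 * α)) * ρ * mpow σ ((1 - α) / (2 * α))) α).trace.re

section DataProcessing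
variable {ι m n k : Type*} [Fintype ι] [Fintype m] [DecidableEq m] [Fintype n] [DecidableEq n]
  [Fintype k] [DecidableEq k]

theorem kmap_posSemidef (K : ι → Matrix n m ℂ) {X : Matrix m m ℂ} (hX : X.PosSemidef) :
    (kmap K X).PosSemidef :=
  Matrix.posSemidef_sum _ fun i _ => hX.mul_mul_conjTranspose_same (K i)

theorem kmap_sub (K : ι → Matrix n m ℂ) (X Y : Matrix m m ℂ) :
    kmap K (X - Y) = kmap K X - kmap K Y := by
  simp only [kmap, Matrix.mul_sub, Matrix.sub_mul, Finset.sum_sub_distrib]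

theorem kmap_smul (K : ι → Matrix n m ℂ) (c : ℂ) (X : Matrix m m ℂ) :
    kmap K (c • X) = c • kmap K X := by
  simp only [kmap, Matrix.mul_smul, Matrix.smul_mul, Finset.smul_sum]

theorem trace_kmap {K : ι → Matrix n m ℂ} (hK : ∑ i, (K i)ᴴ * K i = 1) (X : Matrix m m ℂ) :
    (kmap K X).trace = X.trace := by
  rw [kmap, Matrix.trace_sum]
  simp only [Matrix.mul_assoc]
  simp only [fun i => Matrix.trace_mul_comm (K i) (X * (K i)ᴴ), Matrix.mul_assoc]
  rw [← Matrix.trace_sum, ← Finset.mul_sum, hK, Matrix.mul_one]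

theorem mul_kmap_mul (K : ι → Matrix n m ℂ) (X : Matrix m m ℂ) (A : Matrix k n ℂ)
    (B : Matrix n k ℂ) : A * kmap K X * B = ∑ i, A * (K i * X * (K i)ᴴ) * B := by
  rw [kmap, Matrix.mul_sum, Matrix.sum_mul]

theorem hs_mpow_half {M : Matrix n n ℂ} (hM : M.PosSemidef) :
    hs (mpow M (1 / 2)) = M.trace.re := by
  have h := trace_conjTranspose_mul_self (mpow M (1 / 2))
  rw [mpow_conjTranspose, mpow_mul_mpow hM (by norm_num)] at h
  norm_num at h
  rw [mpow_one hM.1] at h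
  rw [h, Complex.ofReal_re]

/-- The analytic family interpolating the two sides of the data-processing inequality. -/
def interpFam (K : Matrix n m ℂ) (U σ : Matrix m m ℂ) (ω V : Matrix n n ℂ) (z : ℂ) :
    Matrix m n ℂ :=
  cmpow U ((1 - z) / 2) * (cmpow σ (z / 2) * (Kᴴ * (cmpow ω (-z / 2) * cmpow V (z / 2))))

theorem stripBoundedMat_interpFam (K : Matrix n m ℂ) {U σ : Matrix m m ℂ} {ω V : Matrix n n ℂ}
    (hU : U.PosSemidef) (hσ : σ.PosSemidef) (hω : ω.PosSemidef) (hV : V.PosSemidef) :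
    StripBoundedMat (interpFam K U σ ω V) := by
  refine (stripBoundedMat_cmpow hU (-1 / 2) (1 / 2) ?_).mul
    ((stripBoundedMat_cmpow hσ (1 / 2) 0 ?_).mul ((StripBoundedMat.const _).mul
      ((stripBoundedMat_cmpow hω (-1 / 2) 0 ?_).mul (stripBoundedMat_cmpow hV (1 / 2) 0 ?_))))
  all_goals
    intro z
    push_cast
    ring

theorem sum_hs_interpFam_zero {K : ι → Matrix n m ℂ} (hK : ∑ i, (K i)ᴴ * K i = 1)
    {U σ : Matrix m m ℂ} {ω V : Matrix n n ℂ}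
    (hU : U.PosSemidef) (hσ : σ.PosSemidef) (hω : ω.PosSemidef) (hV : V.PosSemidef)
    {z : ℂ} (hz : z.re = 0) : ∑ i, hs (interpFam (K i) U σ ω V z) ≤ U.trace.re := by
  have hz2 : (z / 2).re = 0 := by simp [hz]
  have hz3 : (-z / 2).re = 0 := by simp [hz]
  set T := mpow U (1 / 2) * (cmpow U (-z / 2) * cmpow σ (z / 2)) with hT
  have e : cmpow U ((1 - z) / 2) = mpow U (1 / 2) * cmpow U (-z / 2) := by
    rw [← cmpow_ofReal hU (by norm_num : (1 / 2 : ℝ) ≠ 0), ← cmpow_add hU]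
    congr 1
    push_cast
    ring
  have h1 : ∀ i, hs (interpFam (K i) U σ ω V z) ≤ hs (T * (K i)ᴴ) := by
    intro i
    have : interpFam (K i) U σ ω V z = T * (K i)ᴴ * cmpow ω (-z / 2) * cmpow V (z / 2) := by
      simp only [interpFam, e, hT, Matrix.mul_assoc]
    rw [this]
    exact (hs_mul_contraction (cmpow_contraction' hV hz2) _).trans
      (hs_mul_contraction (cmpow_contraction' hω hz3) _)
  have h2 : ∑ i, hs (T * (K i)ᴴ) = hs T := by
    have : ((∑ i, hs (T * (K i)ᴴ) : ℝ) : ℂ) = (hs T : ℂ) := by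
      rw [← trace_mul_conjTranspose_self T, Complex.ofReal_sum]
      simp only [← trace_mul_conjTranspose_self]
      rw [← Matrix.trace_sum]
      congr 1
      calc _ = ∑ i, T * ((K i)ᴴ * K i) * Tᴴ := by
            refine Finset.sum_congr rfl fun i _ => ?_
            simp only [Matrix.conjTranspose_mul, Matrix.conjTranspose_conjTranspose,
              Matrix.mul_assoc]
        _ = T * Tᴴ := by
            rw [← Finset.sum_mul, ← Finset.mul_sum, hK, Matrix.mul_one]
    exact_mod_cast this
  have h3 : hs T ≤ U.trace.re := by
    rw [hT, ← Matrix.mul_assoc, ← hs_mpow_half hU]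
    exact (hs_mul_contraction (cmpow_contraction' hσ hz2) _).trans
      (hs_mul_contraction (cmpow_contraction' hU hz3) _)
  exact (Finset.sum_le_sum fun i _ => h1 i).trans (h2.le.trans h3)

theorem sum_hs_interpFam_one {K : ι → Matrix n m ℂ}
    {U σ : Matrix m m ℂ} {V : Matrix n n ℂ}
    (hU : U.PosSemidef) (hσ : σ.PosSemidef) (hV : V.PosSemidef)
    {z : ℂ} (hz : z.re = 1) :
    ∑ i, hs (interpFam (K i) U σ (kmap K σ) V z) ≤ V.trace.re := by
  have hω := kmap_posSemidef K hσ
  set ω := kmap K σ with hωdef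
  have hz2 : ((z - 1) / 2).re = 0 := by simp [hz]
  have hz3 : ((1 - z) / 2).re = 0 := by simp [hz]
  set M := cmpow ω ((1 - z) / 2) * (mpow V (1 / 2) * cmpow V ((z - 1) / 2)) with hM
  have eσ : cmpow σ (z / 2) = cmpow σ ((z - 1) / 2) * mpow σ (1 / 2) := by
    rw [← cmpow_ofReal hσ (by norm_num : (1 / 2 : ℝ) ≠ 0), ← cmpow_add hσ]
    congr 1
    push_cast
    ring
  have eω : cmpow ω (-z / 2) = mpow ω (-(1 / 2)) * cmpow ω ((1 - z) / 2) := by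
    rw [← cmpow_ofReal hω (by norm_num : (-(1 / 2) : ℝ) ≠ 0), ← cmpow_add hω]
    congr 1
    push_cast
    ring
  have eV : cmpow V (z / 2) = mpow V (1 / 2) * cmpow V ((z - 1) / 2) := by
    rw [← cmpow_ofReal hV (by norm_num : (1 / 2 : ℝ) ≠ 0), ← cmpow_add hV]
    congr 1
    push_cast
    ring
  have h1 : ∀ i, hs (interpFam (K i) U σ ω V z) ≤
      hs (mpow σ (1 / 2) * (K i)ᴴ * mpow ω (-(1 / 2)) * M) := by
    intro i
    have : interpFam (K i) U σ ω V z = cmpow U ((1 - z) / 2) * (cmpow σ ((z - 1) / 2) *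
        (mpow σ (1 / 2) * (K i)ᴴ * mpow ω (-(1 / 2)) * M)) := by
      simp only [interpFam, eσ, eω, eV, hM, Matrix.mul_assoc]
    rw [this]
    exact (hs_contraction_mul (cmpow_contraction hU hz3) _).trans
      (hs_contraction_mul (cmpow_contraction hσ hz2) _)
  have h2 : ((∑ i, hs (mpow σ (1 / 2) * (K i)ᴴ * mpow ω (-(1 / 2)) * M) : ℝ) : ℂ) =
      (Mᴴ * suppProj ω * M).trace := by
    rw [Complex.ofReal_sum]
    simp only [← trace_conjTranspose_mul_self]
    rw [← Matrix.trace_sum]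
    congr 1
    have hhalf : mpow σ (1 / 2) * mpow σ (1 / 2) = σ := by
      rw [mpow_mul_mpow hσ (by norm_num)]
      norm_num
      exact mpow_one hσ.1
    calc _ = ∑ i, Mᴴ * mpow ω (-(1 / 2)) * (K i * (mpow σ (1 / 2) * mpow σ (1 / 2)) * (K i)ᴴ) *
          (mpow ω (-(1 / 2)) * M) := by
          refine Finset.sum_congr rfl fun i _ => ?_
          simp only [Matrix.conjTranspose_mul, Matrix.conjTranspose_conjTranspose,
            Matrix.mul_assoc, mpow_conjTranspose]
      _ = Mᴴ * (mpow ω (-(1 / 2)) * ω * mpow ω (-(1 / 2))) * M := by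
          rw [hhalf, ← mul_kmap_mul, ← hωdef]
          simp only [Matrix.mul_assoc]
      _ = Mᴴ * suppProj ω * M := by
          conv_lhs => arg 1; arg 2; arg 1; arg 2; rw [← mpow_one hω.1]
          rw [mpow_mul_mpow hω (by norm_num), show (-(1 / 2) + 1 : ℝ) = 1 / 2 by norm_num,
            mpow_mul_mpow_neg hω (by norm_num)]
  have h3 : (Mᴴ * suppProj ω * M).trace.re ≤ hs M := by
    have h := ((one_sub_suppProj_posSemidef hω).conjTranspose_mul_mul_same M).trace_nonneg
    rw [Matrix.mul_sub, Matrix.sub_mul, Matrix.mul_one, Matrix.trace_sub,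
      trace_conjTranspose_mul_self] at h
    have h' := (Complex.le_def.1 h).1
    simp only [Complex.zero_re, Complex.sub_re, Complex.ofReal_re] at h'
    linarith
  have h4 : hs M ≤ V.trace.re := by
    rw [hM, ← hs_mpow_half hV]
    exact (hs_contraction_mul (cmpow_contraction hω hz3) _).trans
      (hs_mul_contraction (cmpow_contraction' hV hz2) _)
  have h5 := congrArg Complex.re h2
  rw [Complex.ofReal_re] at h5
  exact (Finset.sum_le_sum fun i _ => h1 i).trans (h5.le.trans (h3.trans h4))

/-- The sandwiched Rényi trace functional is monotone under channels for `α > 1`. -/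
theorem renyiQ_kmap_le {α : ℝ} (hα : 1 < α) {K : ι → Matrix n m ℂ}
    (hK : ∑ i, (K i)ᴴ * K i = 1) {ρ σ : Matrix m m ℂ} (hρ : ρ.PosSemidef) (hσ : σ.PosSemidef)
    (hsupp : suppSubset ρ σ) : renyiQ α (kmap K ρ) (kmap K σ) ≤ renyiQ α ρ σ := by
  have hα0 : 0 < α := by linarith
  set s := (1 - α) / (2 * α) with hs_def
  have hs0 : s ≠ 0 := div_ne_zero (by linarith) (by linarith)
  have hω := kmap_posSemidef K hσ
  have hρ' := kmap_posSemidef K hρ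
  set ω := kmap K σ with hω_def
  set X := mpow σ s * ρ * mpow σ s with hX
  set Y := mpow ω s * kmap K ρ * mpow ω s with hY
  have hXp : X.PosSemidef := mpow_conj_posSemidef hρ s
  have hYp : Y.PosSemidef := mpow_conj_posSemidef hρ' s
  have hQ1 : renyiQ α ρ σ = (mpow X α).trace.re := rfl
  have hQ2 : renyiQ α (kmap K ρ) ω = (mpow Y α).trace.re := rfl
  have hU := mpow_posSemidef hXp α
  have hV := mpow_posSemidef hYp α
  rw [hQ1, hQ2]
  set u := (mpow X α).trace.re with hu
  set t := (mpow Y α).trace.re with ht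
  have hu0 : 0 ≤ u := (Complex.le_def.1 hU.trace_nonneg).1
  have ht0 : 0 ≤ t := (Complex.le_def.1 hV.trace_nonneg).1
  set θ := (α - 1) / α with hθ
  have hθ0 : 0 < θ := div_pos (by linarith) hα0
  have hθ1 : θ < 1 := (div_lt_one hα0).2 (by linarith)
  have key := sum_hs_le_interp (F := fun i => interpFam (K i) (mpow X α) σ ω (mpow Y α))
    (fun i => stripBoundedMat_interpFam (K i) hU hσ hω hV) hu0 ht0
    (fun z hz => sum_hs_interpFam_zero hK hU hσ hω hV hz)
    (fun z hz => sum_hs_interpFam_one hU hσ hV hz) hθ0.le hθ1.le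
  have hfam : ∀ i, interpFam (K i) (mpow X α) σ ω (mpow Y α) θ =
      mpow X (1 / 2) * (mpow σ (-s) * ((K i)ᴴ * (mpow ω s * mpow Y ((α - 1) / 2)))) := by
    intro i
    rw [interpFam, show ((1 - (θ : ℂ)) / 2) = (((1 - θ) / 2 : ℝ) : ℂ) by push_cast; ring,
      show ((θ : ℂ) / 2) = ((θ / 2 : ℝ) : ℂ) by push_cast; ring,
      show (-(θ : ℂ) / 2) = ((-θ / 2 : ℝ) : ℂ) by push_cast; ring,
      cmpow_ofReal hU (by linarith), cmpow_ofReal hσ (by linarith),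
      cmpow_ofReal hω (by linarith), cmpow_ofReal hV (by linarith), mpow_mpow hXp,
      mpow_mpow hYp]
    have e1 : α * ((1 - θ) / 2) = 1 / 2 := by rw [hθ]; field_simp; ring
    have e2 : θ / 2 = -s := by rw [hθ, hs_def]; field_simp; ring
    have e3 : -θ / 2 = s := by rw [hθ, hs_def]; field_simp; ring
    have e4 : α * (θ / 2) = (α - 1) / 2 := by rw [hθ]; field_simp
    rw [e1, e4, e3, e2]
  have hsum : ∑ i, hs (interpFam (K i) (mpow X α) σ ω (mpow Y α) θ) = t := by
    have : ((∑ i, hs (interpFam (K i) (mpow X α) σ ω (mpow Y α) θ) : ℝ) : ℂ) =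
        (mpow Y α).trace := by
      simp only [hfam]
      rw [Complex.ofReal_sum]
      simp only [← trace_conjTranspose_mul_self]
      rw [← Matrix.trace_sum]
      have hhalf : mpow X (1 / 2) * mpow X (1 / 2) = X := by
        rw [mpow_mul_mpow hXp (by norm_num)]
        norm_num
        exact mpow_one hXp.1
      congr 1
      calc _ = ∑ i, mpow Y ((α - 1) / 2) * mpow ω s * (K i * (mpow σ (-s) *
            (mpow X (1 / 2) * mpow X (1 / 2)) * mpow σ (-s)) * (K i)ᴴ) *
            (mpow ω s * mpow Y ((α - 1) / 2)) := by
            refine Finset.sum_congr rfl fun i _ => ?_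
            simp only [Matrix.conjTranspose_mul, Matrix.conjTranspose_conjTranspose,
              Matrix.mul_assoc, mpow_conjTranspose]
        _ = mpow Y ((α - 1) / 2) * Y * mpow Y ((α - 1) / 2) := by
            rw [hhalf, hX, mpow_conj_cancel hρ.1 hσ hsupp hs0, ← mul_kmap_mul, hY]
            simp only [Matrix.mul_assoc]
        _ = mpow Y α := by
            conv_lhs => arg 1; arg 2; rw [← mpow_one hYp.1]
            rw [mpow_mul_mpow hYp (by linarith), mpow_mul_mpow hYp (by linarith)]
            congr 1
            ring
    have h := congrArg Complex.re this
    rwa [Complex.ofReal_re] at h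
  rw [hsum] at key
  rcases ht0.eq_or_lt with h | h
  · rw [← h]; exact hu0
  · have h1 : t ^ (1 - θ) ≤ u ^ (1 - θ) := by
      have h2 : t ^ (1 - θ) * t ^ θ ≤ u ^ (1 - θ) * t ^ θ := by
        rw [← Real.rpow_add h]
        simpa using key
      exact le_of_mul_le_mul_right h2 (Real.rpow_pos_of_pos h θ)
    exact (Real.rpow_le_rpow_iff ht0 hu0 (by linarith)).1 h1

end DataProcessing

/-! ### A Jensen trace inequality and the dimension bound -/

section Dimension
variable {m n k : Type*} [Fintype m] [DecidableEq m] [Fintype n] [DecidableEq n]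
  [Fintype k] [DecidableEq k]

theorem contraction_swap {C : Matrix m n ℂ} (h : (1 - Cᴴ * C).PosSemidef) :
    (1 - C * Cᴴ).PosSemidef := by
  let _ : Invertible (1 : Matrix m m ℂ) := invertibleOne
  let _ : Invertible (1 : Matrix n n ℂ) := invertibleOne
  have h1 := (Matrix.PosDef.fromBlocks₁₁ C (1 : Matrix n n ℂ)
    (Matrix.PosDef.one (n := m) (R := ℂ))).2 (by simpa using h)
  have h2 := (Matrix.PosDef.fromBlocks₂₂ (1 : Matrix m m ℂ) C
    (Matrix.PosDef.one (n := n) (R := ℂ))).1 h1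
  simpa using h2

theorem rpow_sum_le_of_sum_le_one {ι : Type*} [Fintype ι] {w x : ι → ℝ} (hw : ∀ i, 0 ≤ w i)
    (hw1 : ∑ i, w i ≤ 1) (hx : ∀ i, 0 ≤ x i) {α : ℝ} (hα : 1 ≤ α) :
    (∑ i, w i * x i) ^ α ≤ ∑ i, w i * x i ^ α := by
  have h := Real.rpow_arith_mean_le_arith_mean_rpow (Finset.univ : Finset (Option ι))
    (fun o => o.elim (1 - ∑ i, w i) w) (fun o => o.elim 0 x)
    (by rintro (_ | i) _; exacts [sub_nonneg.2 hw1, hw i])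
    (by rw [Fintype.sum_option]; simp)
    (by rintro (_ | i) _; exacts [le_rfl, hx i]) hα
  rw [Fintype.sum_option, Fintype.sum_option] at h
  simpa [Real.zero_rpow (show α ≠ 0 by linarith)] using h

theorem mul_diagonal_mul_conjTranspose_diag (Z : Matrix m n ℂ) (d : n → ℝ) (i : m) :
    (Z * Matrix.diagonal (fun j => (d j : ℂ)) * Zᴴ) i i =
      ((∑ j, ‖Z i j‖ ^ 2 * d j : ℝ) : ℂ) := by
  rw [Matrix.mul_apply, Complex.ofReal_sum]
  refine Finset.sum_congr rfl fun j _ => ?_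
  rw [Matrix.mul_diagonal, Matrix.conjTranspose_apply, Complex.star_def, Complex.ofReal_mul,
    Complex.ofReal_pow, ← Complex.mul_conj']
  ring

theorem trace_mpow_conj_le {N : Matrix n n ℂ} (hN : N.PosSemidef) {C : Matrix m n ℂ}
    (hC : (1 - C * Cᴴ).PosSemidef) {α : ℝ} (hα : 1 ≤ α) :
    (mpow (C * N * Cᴴ) α).trace.re ≤ (C * mpow N α * Cᴴ).trace.re := by
  have hM := hN.mul_mul_conjTranspose_same C
  set M := C * N * Cᴴ with hMdef
  set V : Matrix m m ℂ := (hM.1.eigenvectorUnitary : Matrix m m ℂ) with hV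
  set W : Matrix n n ℂ := (hN.1.eigenvectorUnitary : Matrix n n ℂ) with hW
  have hVV : Vᴴ * V = 1 := eigenvectorUnitary_conjTranspose_mul hM.1
  have hVV' : V * Vᴴ = 1 := eigenvectorUnitary_mul_conjTranspose hM.1
  have hWW' : W * Wᴴ = 1 := eigenvectorUnitary_mul_conjTranspose hN.1
  set Z := Vᴴ * C * W with hZ
  have hZf : ∀ f : ℝ → ℂ, Z * Matrix.diagonal (fun j => f (hN.1.eigenvalues j)) * Zᴴ =
      Vᴴ * (C * mfun N f * Cᴴ) * V := by
    intro f
    rw [mfun_eq hN.1, ← hW, hZ]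
    simp only [Matrix.conjTranspose_mul, Matrix.conjTranspose_conjTranspose, Matrix.mul_assoc]
  have hdiag : Z * Matrix.diagonal (fun j => (hN.1.eigenvalues j : ℂ)) * Zᴴ =
      Matrix.diagonal (fun i => (hM.1.eigenvalues i : ℂ)) := by
    rw [hZf (fun x => (x : ℂ)), mfun_id hN.1, ← hMdef, Matrix.mul_assoc,
      mul_eigenvectorUnitary hM.1, ← Matrix.mul_assoc, hVV, Matrix.one_mul]
  have heig : ∀ i, hM.1.eigenvalues i = ∑ j, ‖Z i j‖ ^ 2 * hN.1.eigenvalues j := by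
    intro i
    have := congrFun (congrFun hdiag i) i
    rw [mul_diagonal_mul_conjTranspose_diag, Matrix.diagonal_apply_eq] at this
    exact_mod_cast this.symm
  have hweights : ∀ i, ∑ j, ‖Z i j‖ ^ 2 ≤ 1 := by
    intro i
    have h1 := (hC.conjTranspose_mul_mul_same V).diag_nonneg (i := i)
    have h2 : Vᴴ * (1 - C * Cᴴ) * V =
        1 - Z * Matrix.diagonal (fun _ : n => ((1 : ℝ) : ℂ)) * Zᴴ := by
      rw [Matrix.mul_sub, Matrix.sub_mul, Matrix.mul_one, hVV]
      have := hZf fun _ => ((1 : ℝ) : ℂ)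
      rw [this]
      have h1 : mfun N (fun _ => ((1 : ℝ) : ℂ)) = 1 := by simpa using mfun_one hN.1
      rw [h1, Matrix.mul_one]
    rw [h2, Matrix.sub_apply, mul_diagonal_mul_conjTranspose_diag (d := fun _ => 1),
      Matrix.one_apply_eq, ← Complex.ofReal_one, ← Complex.ofReal_sub,
      Complex.zero_le_real] at h1
    simpa using h1
  have htr : (C * mpow N α * Cᴴ).trace =
      ((∑ i, ∑ j, ‖Z i j‖ ^ 2 * hN.1.eigenvalues j ^ α : ℝ) : ℂ) := by
    have : (C * mpow N α * Cᴴ).trace = (Vᴴ * (C * mpow N α * Cᴴ) * V).trace := by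
      rw [Matrix.trace_mul_comm (Vᴴ * _), ← Matrix.mul_assoc, hVV', Matrix.one_mul]
    rw [this, mpow_eq_mfun, ← hZf (fun x => ((x ^ α : ℝ) : ℂ)), Matrix.trace,
      Complex.ofReal_sum]
    exact Finset.sum_congr rfl fun i _ => mul_diagonal_mul_conjTranspose_diag _ _ _
  rw [htr, mpow_eq_mfun, trace_mfun hM.1, ← Complex.ofReal_sum, Complex.ofReal_re,
    Complex.ofReal_re]
  refine Finset.sum_le_sum fun i _ => ?_
  rw [heig i]
  exact rpow_sum_le_of_sum_le_one (fun j => by positivity) (hweights i)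
    (fun j => hN.eigenvalues_nonneg j) hα

theorem one_sub_conj_inv_sqrt_posSemidef {R M : Matrix n n ℂ} (hM : M.PosSemidef)
    (h : (M - R).PosSemidef) :
    (1 - mpow M (-(1 / 2)) * R * mpow M (-(1 / 2))).PosSemidef := by
  have h1 := h.mul_mul_conjTranspose_same (mpow M (-(1 / 2)))
  have h2 := (one_sub_suppProj_posSemidef hM).add h1
  have h3 : mpow M (-(1 / 2)) * M * mpow M (-(1 / 2)) = suppProj M := by
    conv_lhs => arg 1; arg 2; rw [← mpow_one hM.1]
    rw [mpow_mul_mpow hM (by norm_num), show (-(1 / 2) + 1 : ℝ) = 1 / 2 by norm_num,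
      mpow_mul_mpow_neg hM (by norm_num)]
  rw [mpow_conjTranspose, Matrix.mul_sub, Matrix.sub_mul, h3] at h2
  simpa using h2

theorem suppSubset_of_sub_posSemidef {R M : Matrix n n ℂ} (hR : R.PosSemidef)
    (h : (M - R).PosSemidef) : suppSubset R M :=
  suppSubset_of_le hR (c := 1) (by simpa using h)

theorem suppProj_mul_of_le {T : Matrix n k ℂ} {M : Matrix n n ℂ} (hM : M.PosSemidef)
    (h : (M - T * Tᴴ).PosSemidef) : suppProj M * T = T := by
  have h1 := mul_suppProj_of_suppSubset hM
    (suppSubset_of_sub_posSemidef (Matrix.posSemidef_self_mul_conjTranspose T) h)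
  have h2 : ((1 - suppProj M) * T) * ((1 - suppProj M) * T)ᴴ = 0 := by
    rw [Matrix.conjTranspose_mul, Matrix.conjTranspose_sub, suppProj_conjTranspose,
      Matrix.conjTranspose_one, Matrix.mul_assoc, ← Matrix.mul_assoc T, Matrix.mul_sub, h1,
      Matrix.mul_one, sub_self, Matrix.mul_zero]
  rw [Matrix.self_mul_conjTranspose_eq_zero, Matrix.sub_mul, Matrix.one_mul, sub_eq_zero] at h2
  exact h2.symm

theorem mpow_half_mul_self {M : Matrix n n ℂ} (hM : M.PosSemidef) :
    mpow M (1 / 2) * mpow M (1 / 2) = M := by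
  rw [mpow_mul_mpow hM (by norm_num)]
  norm_num
  exact mpow_one hM.1

theorem trace_mpow_le_of_le {M N : Matrix n n ℂ} (hM : M.PosSemidef) (hN : N.PosSemidef)
    (h : (N - M).PosSemidef) {α : ℝ} (hα : 1 < α) :
    (mpow M α).trace.re ≤ (M * mpow N (α - 1)).trace.re := by
  set T := mpow M (1 / 2) with hT
  have hTT : T * T = M := mpow_half_mul_self hM
  have hTh : Tᴴ = T := mpow_conjTranspose _ _
  have hS : suppProj N * T = T := suppProj_mul_of_le hN (by rwa [hTh, hTT])
  have hS' : T * suppProj N = T := by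
    have := congrArg Matrix.conjTranspose hS
    rwa [Matrix.conjTranspose_mul, hTh, suppProj_conjTranspose] at this
  set C := T * mpow N (-(1 / 2)) with hC
  have hCh : Cᴴ = mpow N (-(1 / 2)) * T := by
    rw [hC, Matrix.conjTranspose_mul, hTh, mpow_conjTranspose]
  have hCC : (1 - C * Cᴴ).PosSemidef := by
    apply contraction_swap
    have := one_sub_conj_inv_sqrt_posSemidef hN h
    rwa [hCh, hC, Matrix.mul_assoc, ← Matrix.mul_assoc T, hTT, ← Matrix.mul_assoc]
  have key := trace_mpow_conj_le hN hCC hα.le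
  have e1 : C * N * Cᴴ = M := by
    rw [hCh, hC]
    calc _ = T * (mpow N (-(1 / 2)) * N * mpow N (-(1 / 2))) * T := by
          simp only [Matrix.mul_assoc]
      _ = M := by
          conv_lhs => arg 1; arg 2; arg 1; arg 2; rw [← mpow_one hN.1]
          rw [mpow_mul_mpow hN (by norm_num), show (-(1 / 2) + 1 : ℝ) = 1 / 2 by norm_num,
            mpow_mul_mpow_neg hN (by norm_num), hS', hTT]
  have e2 : (C * mpow N α * Cᴴ).trace = (M * mpow N (α - 1)).trace := by
    rw [hCh, hC]
    calc _ = (T * (mpow N (-(1 / 2)) * mpow N α * mpow N (-(1 / 2))) * T).trace := by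
          simp only [Matrix.mul_assoc]
      _ = _ := by
          rw [mpow_mul_mpow hN (by linarith), mpow_mul_mpow hN (by linarith),
            Matrix.trace_mul_comm, ← Matrix.mul_assoc, hTT]
          congr 3
          ring
  rwa [e1, e2] at key

theorem mfun_kronecker_one {M : Matrix m m ℂ} (hM : M.IsHermitian) (f : ℝ → ℂ) :
    mfun (M ⊗ₖ (1 : Matrix n n ℂ)) f = mfun M f ⊗ₖ (1 : Matrix n n ℂ) := by
  have hMk : (M ⊗ₖ (1 : Matrix n n ℂ)).IsHermitian := by
    rw [Matrix.IsHermitian, Matrix.conjTranspose_kronecker, hM, Matrix.conjTranspose_one]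
  set U : Matrix m m ℂ := (hM.eigenvectorUnitary : Matrix m m ℂ) with hU
  have hd : ∀ g : ℝ → ℂ, (Matrix.diagonal fun i => g (hM.eigenvalues i)) ⊗ₖ
      (1 : Matrix n n ℂ) = Matrix.diagonal fun p : m × n => g (hM.eigenvalues p.1) := by
    intro g
    rw [← Matrix.diagonal_one, Matrix.diagonal_kronecker_diagonal]
    simp
  have h1 : (M ⊗ₖ (1 : Matrix n n ℂ)) * (U ⊗ₖ (1 : Matrix n n ℂ)) = (U ⊗ₖ (1 : Matrix n n ℂ)) *
      Matrix.diagonal fun p : m × n => ((hM.eigenvalues p.1 : ℝ) : ℂ) := by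
    rw [← hd fun x => (x : ℂ), ← Matrix.mul_kronecker_mul, ← Matrix.mul_kronecker_mul,
      mul_eigenvectorUnitary hM]
  have h2 := mfun_mul_of_mul_diagonal hMk h1 f
  rw [← hd f, ← Matrix.mul_kronecker_mul, ← mfun_mul_eigenvectorUnitary hM] at h2
  have h3 := congrArg (· * (Uᴴ ⊗ₖ (1 : Matrix n n ℂ))) h2
  simp only [Matrix.mul_assoc, ← Matrix.mul_kronecker_mul] at h3
  rw [hU, eigenvectorUnitary_mul_conjTranspose] at h3
  simpa using h3

theorem mpow_kronecker_one {M : Matrix m m ℂ} (hM : M.IsHermitian) (p : ℝ) :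
    mpow (M ⊗ₖ (1 : Matrix n n ℂ)) p = mpow M p ⊗ₖ (1 : Matrix n n ℂ) := by
  rw [mpow_eq_mfun, mpow_eq_mfun, mfun_kronecker_one hM]

theorem ptB_eq_sum_submatrix (M : Matrix (m × n) (m × n) ℂ) :
    ptB M = ∑ b, M.submatrix (fun a => (a, b)) (fun a => (a, b)) := by
  ext a a'
  simp [ptB, Matrix.sum_apply]

theorem ptB_posSemidef {M : Matrix (m × n) (m × n) ℂ} (hM : M.PosSemidef) :
    (ptB M).PosSemidef := by
  rw [ptB_eq_sum_submatrix]
  exact Matrix.posSemidef_sum _ fun b _ => hM.submatrix _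

theorem trace_ptB (M : Matrix (m × n) (m × n) ℂ) : (ptB M).trace = M.trace := by
  simp [ptB, Matrix.trace, Fintype.sum_prod_type]

theorem kronecker_one_mul_apply (X : Matrix m m ℂ) (T : Matrix (m × n) k ℂ) (x : m) (q : n)
    (y : k) : ((X ⊗ₖ (1 : Matrix n n ℂ)) * T) (x, q) y = ∑ x', X x x' * T (x', q) y := by
  simp [Matrix.mul_apply, Fintype.sum_prod_type, Matrix.kroneckerMap_apply, Matrix.one_apply]

theorem mul_kronecker_one_apply (X : Matrix m m ℂ) (T : Matrix k (m × n) ℂ) (x : m) (q : n)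
    (y : k) : (T * (X ⊗ₖ (1 : Matrix n n ℂ))) y (x, q) = ∑ x', T y (x', q) * X x' x := by
  simp [Matrix.mul_apply, Fintype.sum_prod_type, Matrix.kroneckerMap_apply, Matrix.one_apply]

theorem ptB_kronecker_one_mul (X : Matrix m m ℂ) (T : Matrix (m × n) (m × n) ℂ) :
    ptB ((X ⊗ₖ (1 : Matrix n n ℂ)) * T) = X * ptB T := by
  ext a a'
  simp only [ptB, Matrix.of_apply, kronecker_one_mul_apply]
  rw [Matrix.mul_apply, Finset.sum_comm]
  simp only [Matrix.of_apply, Finset.mul_sum]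

theorem ptB_mul_kronecker_one (X : Matrix m m ℂ) (T : Matrix (m × n) (m × n) ℂ) :
    ptB (T * (X ⊗ₖ (1 : Matrix n n ℂ))) = ptB T * X := by
  ext a a'
  simp only [ptB, Matrix.of_apply, mul_kronecker_one_apply]
  rw [Matrix.mul_apply, Finset.sum_comm]
  simp only [Matrix.of_apply, Finset.sum_mul]

theorem ptB_kronecker_one_eq_sum (M : Matrix (m × n) (m × n) ℂ) :
    ptB M ⊗ₖ (1 : Matrix n n ℂ) = ∑ q : n, ∑ r : n,
      ((1 : Matrix m m ℂ) ⊗ₖ Matrix.single q r (1 : ℂ)) * M *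
        ((1 : Matrix m m ℂ) ⊗ₖ Matrix.single q r (1 : ℂ))ᴴ := by
  ext ⟨x, a⟩ ⟨y, b⟩
  simp only [Matrix.sum_apply, Matrix.mul_apply, Fintype.sum_prod_type,
    Matrix.kroneckerMap_apply, Matrix.one_apply, Matrix.conjTranspose_apply, Matrix.single,
    Matrix.of_apply, ptB]
  by_cases hab : a = b
  · subst hab
    simp [ite_and, Finset.sum_ite_eq, apply_ite (starRingEnd ℂ)]
  · simp [ite_and, Finset.sum_ite_eq, hab]

/-- The pinching-type inequality `M ≤ |Q| · Tr_Q M ⊗ 1`. -/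
theorem card_smul_ptB_kronecker_one_sub_posSemidef {M : Matrix (m × n) (m × n) ℂ}
    (hM : M.PosSemidef) :
    (((Fintype.card n : ℝ) : ℂ) • (ptB M ⊗ₖ (1 : Matrix n n ℂ)) - M).PosSemidef := by
  set E : n → n → Matrix (m × n) (m × n) ℂ := fun q r =>
    (1 : Matrix m m ℂ) ⊗ₖ Matrix.single q r (1 : ℂ) with hE
  set P : n → Matrix (m × n) (m × n) ℂ := fun q => E q q with hP
  have hPh : ∀ q, (P q)ᴴ = P q := by
    intro q
    simp [hP, hE, Matrix.conjTranspose_kronecker, Matrix.conjTranspose_single]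
  have hPsum : ∑ q, P q = 1 := by
    ext ⟨x, a⟩ ⟨y, b⟩
    simp only [hP, hE, Matrix.sum_apply, Matrix.kroneckerMap_apply, Matrix.one_apply,
      Matrix.single, Matrix.of_apply, Prod.mk.injEq]
    by_cases hab : a = b
    · subst hab
      simp
    · simp only [hab, and_false, if_false]
      refine Finset.sum_eq_zero fun q _ => ?_
      rw [if_neg (fun h : q = a ∧ q = b => hab (h.1.symm.trans h.2)), mul_zero]
  have h1 : (∑ q, ∑ r ∈ Finset.univ.erase q, E q r * M * (E q r)ᴴ).PosSemidef :=
    Matrix.posSemidef_sum _ fun q _ => Matrix.posSemidef_sum _ fun r _ =>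
      hM.mul_mul_conjTranspose_same _
  have h2 : (∑ q, ∑ r, (P q - P r) * M * (P q - P r)ᴴ).PosSemidef :=
    Matrix.posSemidef_sum _ fun q _ => Matrix.posSemidef_sum _ fun r _ =>
      hM.mul_mul_conjTranspose_same _
  have e1 : ptB M ⊗ₖ (1 : Matrix n n ℂ) = ∑ q, P q * M * P q +
      ∑ q, ∑ r ∈ Finset.univ.erase q, E q r * M * (E q r)ᴴ := by
    rw [ptB_kronecker_one_eq_sum, ← Finset.sum_add_distrib]
    refine Finset.sum_congr rfl fun q _ => ?_
    rw [← Finset.add_sum_erase _ _ (Finset.mem_univ q)]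
    congr 1
    conv_rhs => arg 2; rw [← hPh q]
  have e2 : ∑ q, ∑ r, (P q - P r) * M * (P q - P r)ᴴ =
      ((2 * Fintype.card n : ℝ) : ℂ) • (∑ q, P q * M * P q) - (2 : ℂ) • M := by
    have hcross : ∑ q, ∑ r, P q * M * P r = M := by
      simp only [← Matrix.mul_sum, hPsum, Matrix.mul_one]
      simp only [← Matrix.sum_mul, hPsum, Matrix.one_mul]
    have hcross' : ∑ q, ∑ r, P r * M * P q = M := by rw [Finset.sum_comm, hcross]
    have hexp : ∀ q r, (P q - P r) * M * (P q - P r)ᴴ =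
        P q * M * P q + P r * M * P r - (P q * M * P r + P r * M * P q) := by
      intro q r
      rw [Matrix.conjTranspose_sub, hPh, hPh]
      noncomm_ring
    simp only [hexp, Finset.sum_sub_distrib, Finset.sum_add_distrib, hcross, hcross',
      Finset.sum_const, Finset.card_univ, ← Finset.smul_sum]
    push_cast
    simp only [← Nat.cast_smul_eq_nsmul ℂ]
    module
  have e3 : ((Fintype.card n : ℝ) : ℂ) • (ptB M ⊗ₖ (1 : Matrix n n ℂ)) - M =
      (Fintype.card n : ℝ) • (∑ q, ∑ r ∈ Finset.univ.erase q, E q r * M * (E q r)ᴴ) +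
      (1 / 2 : ℝ) • ∑ q, ∑ r, (P q - P r) * M * (P q - P r)ᴴ := by
    rw [e1, e2]
    simp only [← Complex.coe_smul]
    push_cast
    module
  rw [e3]
  exact (h1.smul (by positivity)).add (h2.smul (by norm_num))

/-- The sandwiched Rényi trace functional with an extra system of dimension `|Q|` appended. -/
theorem renyiQ_kronecker_one_le {α : ℝ} (hα : 1 < α) {τ : Matrix (m × n) (m × n) ℂ}
    (hτ : τ.PosSemidef) {σ : Matrix m m ℂ} (hσ : σ.PosSemidef) :
    renyiQ α τ (σ ⊗ₖ (1 : Matrix n n ℂ)) ≤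
      (Fintype.card n : ℝ) ^ (α - 1) * renyiQ α (ptB τ) σ := by
  unfold renyiQ
  set s := (1 - α) / (2 * α) with hs
  rw [mpow_kronecker_one hσ.1]
  set M := mpow σ s ⊗ₖ (1 : Matrix n n ℂ) * τ * mpow σ s ⊗ₖ (1 : Matrix n n ℂ) with hMdef
  have hMp : M.PosSemidef := by
    have := hτ.mul_mul_conjTranspose_same (mpow σ s ⊗ₖ (1 : Matrix n n ℂ))
    rwa [Matrix.conjTranspose_kronecker, mpow_conjTranspose, Matrix.conjTranspose_one] at this
  have hpt : mpow σ s * ptB τ * mpow σ s = ptB M := by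
    rw [hMdef, ptB_mul_kronecker_one, ptB_kronecker_one_mul]
  rw [hpt]
  have hpM := ptB_posSemidef hMp
  have hk : (ptB M ⊗ₖ (1 : Matrix n n ℂ)).PosSemidef := hpM.kronecker Matrix.PosSemidef.one
  have hNp : (((Fintype.card n : ℝ) : ℂ) • (ptB M ⊗ₖ (1 : Matrix n n ℂ))).PosSemidef :=
    hk.smul (by exact_mod_cast Nat.zero_le _)
  have key := trace_mpow_le_of_le hMp hNp (card_smul_ptB_kronecker_one_sub_posSemidef hMp) hα
  refine key.trans (le_of_eq ?_)
  rw [mpow_smul hk (by positivity), mpow_kronecker_one hpM.1, Matrix.mul_smul,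
    Matrix.trace_smul, ← trace_ptB, ptB_mul_kronecker_one]
  conv_lhs => arg 1; arg 2; arg 1; arg 1; rw [← mpow_one hpM.1]
  rw [mpow_mul_mpow hpM (by linarith), smul_eq_mul, Complex.re_ofReal_mul]
  congr 4
  ring

theorem renyiQ_smul {α : ℝ} (hα : 1 < α) {ρ σ : Matrix n n ℂ} (hρ : ρ.PosSemidef)
    (hσ : σ.PosSemidef) {c : ℝ} (hc : 0 < c) :
    renyiQ α ρ ((c : ℂ) • σ) = c ^ (1 - α) * renyiQ α ρ σ := by
  unfold renyiQ
  set s := (1 - α) / (2 * α) with hs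
  have hX := mpow_conj_posSemidef (M := σ) hρ s
  rw [mpow_smul hσ hc.le]
  have e : ((c ^ s : ℝ) : ℂ) • mpow σ s * ρ * ((c ^ s : ℝ) : ℂ) • mpow σ s =
      ((c ^ (2 * s) : ℝ) : ℂ) • (mpow σ s * ρ * mpow σ s) := by
    rw [Matrix.smul_mul, Matrix.smul_mul, Matrix.mul_smul, smul_smul, ← Complex.ofReal_mul,
      ← Real.rpow_add hc, two_mul]
  rw [e, mpow_smul hX (by positivity), Matrix.trace_smul, smul_eq_mul, Complex.re_ofReal_mul,
    ← Real.rpow_mul hc.le]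
  congr 2
  rw [hs]
  field_simp

theorem renyiQ_pos {α : ℝ} (hα : 1 < α) {ρ σ : Matrix n n ℂ} (hρ : ρ.PosSemidef)
    (hσ : σ.PosSemidef) (h : suppSubset ρ σ) (hne : ρ ≠ 0) : 0 < renyiQ α ρ σ := by
  unfold renyiQ
  set s := (1 - α) / (2 * α) with hs
  have hs0 : s ≠ 0 := div_ne_zero (by linarith) (by linarith)
  have hX := mpow_conj_posSemidef (M := σ) hρ s
  set X := mpow σ s * ρ * mpow σ s with hXdef
  have hp := mpow_posSemidef hX α
  have h0 := hp.trace_nonneg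
  refine lt_of_le_of_ne (Complex.le_def.1 h0).1 fun h1 => hne ?_
  have h2 : (mpow X α).trace = 0 :=
    Complex.ext h1.symm (Complex.le_def.1 h0).2.symm
  rw [hp.trace_eq_zero_iff] at h2
  have h3 : X = 0 := by
    rw [← mpow_one hX.1, show (1 : ℝ) = α * α⁻¹ by field_simp, ← mpow_mpow hX, h2,
      mpow_eq_mfun, ← zero_smul ℂ (1 : Matrix n n ℂ), ← Complex.ofReal_zero,
      mfun_smul Matrix.isHermitian_one]
    simp only [zero_mul, Real.zero_rpow (inv_ne_zero (show α ≠ 0 by linarith))]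
    have := mfun_const_mul (Matrix.isHermitian_one (α := ℂ) (n := n)) 0 fun _ => 1
    simpa using this
  have h4 := mpow_conj_cancel hρ.1 hσ h hs0
  rw [← hXdef, h3] at h4
  simpa using h4.symm

end Dimension

/-! ### Monotonicity of the fidelity under partial trace -/

section Fidelity
variable {m n k : Type*} [Fintype m] [DecidableEq m] [Fintype n] [DecidableEq n]
  [Fintype k] [DecidableEq k]

theorem re_trace_conjTranspose_mul_le (A B : Matrix m n ℂ) :
    (Aᴴ * B).trace.re ≤ √(hs A) * √(hs B) := by
  have h := norm_sum_star_mul_le (fun p : m × n => A p.1 p.2) fun p => B p.1 p.2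
  have e : (Aᴴ * B).trace = ∑ p : m × n, star (A p.1 p.2) * B p.1 p.2 := by
    simp only [Matrix.trace, Matrix.diag, Matrix.mul_apply, Matrix.conjTranspose_apply]
    rw [Fintype.sum_prod_type, Finset.sum_comm]
  rw [e]
  refine (Complex.re_le_norm _).trans ?_
  simpa [hs, Fintype.sum_prod_type] using h

theorem mul_suppProj_conjTranspose_mul_self (M : Matrix m n ℂ) : M * suppProj (Mᴴ * M) = M := by
  have hH : (Mᴴ * M).PosSemidef := Matrix.posSemidef_conjTranspose_mul_self M
  have h1 := mul_one_sub_suppProj hH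
  rw [Matrix.conjTranspose_mul_self_mul_eq_zero, Matrix.mul_sub, Matrix.mul_one, sub_eq_zero] at h1
  exact h1.symm

theorem mpow_mul_self_mul_mpow {M : Matrix n n ℂ} (hM : M.PosSemidef) {p q : ℝ} (hp : p + 1 ≠ 0)
    (hpq : p + 1 + q ≠ 0) : mpow M p * M * mpow M q = mpow M (p + 1 + q) := by
  conv_lhs => arg 1; arg 2; rw [← mpow_one hM.1]
  rw [mpow_mul_mpow hM hp, mpow_mul_mpow hM hpq]

theorem re_trace_mul_contraction_le (M : Matrix n n ℂ) {G : Matrix n n ℂ}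
    (hG : (1 - G * Gᴴ).PosSemidef) : (M * G).trace.re ≤ traceNorm M := by
  have hH : (Mᴴ * M).PosSemidef := Matrix.posSemidef_conjTranspose_mul_self M
  set H := Mᴴ * M with hHdef
  have hn : 0 ≤ traceNorm M :=
    (Complex.le_def.1 (mpow_posSemidef hH (1 / 2)).trace_nonneg).1
  set A := mpow H (-(1 / 4)) * Mᴴ with hA
  have hAh : Aᴴ = M * mpow H (-(1 / 4)) := by
    rw [hA, Matrix.conjTranspose_mul, Matrix.conjTranspose_conjTranspose, mpow_conjTranspose]
  have hMG : M * G = Aᴴ * (mpow H (1 / 4) * G) := by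
    rw [hAh, Matrix.mul_assoc, ← Matrix.mul_assoc (mpow H _), mpow_neg_mul_mpow hH (by norm_num),
      ← Matrix.mul_assoc, mul_suppProj_conjTranspose_mul_self]
  have h1 : hs A = traceNorm M := by
    have h := trace_mul_conjTranspose_self A
    rw [hAh, hA, Matrix.mul_assoc, ← Matrix.mul_assoc Mᴴ, ← hHdef, ← Matrix.mul_assoc,
      mpow_mul_self_mul_mpow hH (by norm_num) (by norm_num)] at h
    rw [traceNorm, ← hHdef, ← Complex.ofReal_re (hs A), ← h]
    norm_num
  have h2 : hs (mpow H (1 / 4)) = traceNorm M := by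
    have h := trace_mul_conjTranspose_self (mpow H (1 / 4))
    rw [mpow_conjTranspose, mpow_mul_mpow hH (by norm_num)] at h
    rw [traceNorm, ← hHdef, ← Complex.ofReal_re (hs _), ← h]
    norm_num
  calc (M * G).trace.re ≤ √(hs A) * √(hs (mpow H (1 / 4) * G)) := by
        rw [hMG]; exact re_trace_conjTranspose_mul_le _ _
    _ ≤ √(traceNorm M) * √(traceNorm M) := by
        rw [h1, ← h2]
        gcongr
        exact hs_mul_contraction hG _
    _ = traceNorm M := Real.mul_self_sqrt hn

theorem exists_contraction_traceNorm_eq (M : Matrix n n ℂ) :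
    ∃ G : Matrix n n ℂ, (1 - G * Gᴴ).PosSemidef ∧ traceNorm M = (G * M).trace.re := by
  have hH : (Mᴴ * M).PosSemidef := Matrix.posSemidef_conjTranspose_mul_self M
  refine ⟨mpow (Mᴴ * M) (-(1 / 2)) * Mᴴ, ?_, ?_⟩
  · have := one_sub_conj_inv_sqrt_posSemidef (R := Mᴴ * M) hH (by
      rw [sub_self]; exact Matrix.PosSemidef.zero)
    rwa [Matrix.conjTranspose_mul, Matrix.conjTranspose_conjTranspose, mpow_conjTranspose,
      Matrix.mul_assoc, ← Matrix.mul_assoc Mᴴ, ← Matrix.mul_assoc]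
  · rw [traceNorm, Matrix.mul_assoc]
    conv_rhs => arg 1; arg 1; arg 2; rw [← mpow_one hH.1]
    rw [mpow_mul_mpow hH (by norm_num)]
    norm_num

theorem exists_contraction_of_le {T : Matrix n k ℂ} {A : Matrix n n ℂ} (hA : A.PosSemidef)
    (h : (A - T * Tᴴ).PosSemidef) :
    ∃ C : Matrix n k ℂ, T = mpow A (1 / 2) * C ∧ (1 - C * Cᴴ).PosSemidef := by
  refine ⟨mpow A (-(1 / 2)) * T, ?_, ?_⟩
  · rw [← Matrix.mul_assoc, mpow_mul_mpow_neg hA (by norm_num), suppProj_mul_of_le hA h]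
  · have := one_sub_conj_inv_sqrt_posSemidef hA h
    rwa [Matrix.conjTranspose_mul, mpow_conjTranspose, Matrix.mul_assoc, ← Matrix.mul_assoc T,
      ← Matrix.mul_assoc]

theorem re_trace_conjTranspose_mul_le_traceNorm {T R : Matrix n k ℂ} {A B : Matrix n n ℂ}
    (hA : A.PosSemidef) (hB : B.PosSemidef) (hT : (A - T * Tᴴ).PosSemidef)
    (hR : (B - R * Rᴴ).PosSemidef) :
    (Tᴴ * R).trace.re ≤ traceNorm (mpow A (1 / 2) * mpow B (1 / 2)) := by
  obtain ⟨C, rfl, hC⟩ := exists_contraction_of_le hA hT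
  obtain ⟨F, rfl, hF⟩ := exists_contraction_of_le hB hR
  have e : ((mpow A (1 / 2) * C)ᴴ * (mpow B (1 / 2) * F)).trace =
      (mpow A (1 / 2) * mpow B (1 / 2) * (F * Cᴴ)).trace := by
    rw [Matrix.conjTranspose_mul, mpow_conjTranspose, Matrix.mul_assoc, Matrix.trace_mul_comm]
    simp only [Matrix.mul_assoc]
  rw [e]
  apply re_trace_mul_contraction_le
  have h1 : (1 - Cᴴ * C).PosSemidef := by
    have := contraction_swap (C := Cᴴ) (by simpa using hC)
    simpa using this
  have h2 := hF.add (h1.mul_mul_conjTranspose_same F)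
  convert h2 using 1
  simp only [Matrix.mul_sub, Matrix.sub_mul, Matrix.mul_one, Matrix.conjTranspose_mul,
    Matrix.conjTranspose_conjTranspose, Matrix.mul_assoc]
  abel

/-- Move the second tensor factor of the row index to the column index. -/
def rowToCol (T : Matrix (m × n) k ℂ) : Matrix m (n × k) ℂ :=
  Matrix.of fun x p => T (x, p.1) p.2

theorem rowToCol_mul_conjTranspose (T : Matrix (m × n) k ℂ) :
    rowToCol T * (rowToCol T)ᴴ = ptB (T * Tᴴ) := by
  ext x y
  simp [rowToCol, ptB, Matrix.mul_apply, Fintype.sum_prod_type]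

theorem trace_rowToCol (T R : Matrix (m × n) k ℂ) :
    ((rowToCol T)ᴴ * rowToCol R).trace = (Tᴴ * R).trace := by
  simp only [Matrix.trace, Matrix.diag, Matrix.mul_apply, rowToCol, Fintype.sum_prod_type,
    Matrix.conjTranspose_apply, Matrix.of_apply]
  rw [Finset.sum_comm]
  refine Finset.sum_congr rfl fun _ _ => ?_
  rw [Finset.sum_comm]

theorem ptB_sub (M N : Matrix (m × n) (m × n) ℂ) : ptB (M - N) = ptB M - ptB N := by
  ext x y
  simp [ptB]

theorem traceNorm_ptB_le {τ π : Matrix (m × n) (m × n) ℂ} (hτ : τ.PosSemidef)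
    (hπ : π.PosSemidef) :
    traceNorm (mpow τ (1 / 2) * mpow π (1 / 2)) ≤
      traceNorm (mpow (ptB τ) (1 / 2) * mpow (ptB π) (1 / 2)) := by
  obtain ⟨G, hG, hGeq⟩ := exists_contraction_traceNorm_eq (mpow τ (1 / 2) * mpow π (1 / 2))
  have e : (G * (mpow τ (1 / 2) * mpow π (1 / 2))).trace =
      ((rowToCol (mpow τ (1 / 2) * Gᴴ))ᴴ * rowToCol (mpow π (1 / 2))).trace := by
    rw [trace_rowToCol, Matrix.conjTranspose_mul, Matrix.conjTranspose_conjTranspose,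
      mpow_conjTranspose, Matrix.mul_assoc]
  rw [hGeq, e]
  apply re_trace_conjTranspose_mul_le_traceNorm (ptB_posSemidef hτ) (ptB_posSemidef hπ)
  · rw [rowToCol_mul_conjTranspose, ← ptB_sub]
    apply ptB_posSemidef
    have h1 : (1 - Gᴴ * G).PosSemidef := by
      have := contraction_swap (C := Gᴴ) (by simpa using hG)
      simpa using this
    have h2 := h1.mul_mul_conjTranspose_same (mpow τ (1 / 2))
    convert h2 using 1
    rw [Matrix.mul_sub, Matrix.sub_mul, Matrix.mul_one, mpow_conjTranspose,
      mpow_half_mul_self hτ, Matrix.conjTranspose_mul, Matrix.conjTranspose_conjTranspose,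
      mpow_conjTranspose]
    simp only [Matrix.mul_assoc]
  · rw [rowToCol_mul_conjTranspose, mpow_conjTranspose, mpow_half_mul_self hπ, sub_self]
    exact Matrix.PosSemidef.zero

theorem traceNorm_nonneg (M : Matrix n n ℂ) : 0 ≤ traceNorm M :=
  (Complex.le_def.1
    (mpow_posSemidef (Matrix.posSemidef_conjTranspose_mul_self M) (1 / 2)).trace_nonneg).1

theorem pDist_ptB_le {τ π : Matrix (m × n) (m × n) ℂ} (hτ : τ.PosSemidef) (hπ : π.PosSemidef) :
    pDist (ptB τ) (ptB π) ≤ pDist τ π := by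
  have h : gFid τ π ≤ gFid (ptB τ) (ptB π) := by
    unfold gFid
    rw [trace_ptB, trace_ptB]
    gcongr
    exact traceNorm_ptB_le hτ hπ
  have h0 : 0 ≤ gFid τ π := add_nonneg (traceNorm_nonneg _) (Real.sqrt_nonneg _)
  unfold pDist
  gcongr

end Fidelity

/-! ### Kraus representations -/

section Kraus
variable {m n k : Type*} [Fintype m] [DecidableEq m] [Fintype n] [DecidableEq n]
  [Fintype k] [DecidableEq k]

theorem exists_eq_conjTranspose_mul_self {M : Matrix n n ℂ} (hM : M.PosSemidef) :
    ∃ W : Matrix n n ℂ, M = Wᴴ * W :=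
  ⟨mpow M (1 / 2), by rw [mpow_conjTranspose, mpow_half_mul_self hM]⟩

/-- Maps admitting a normalized Kraus representation. -/
def IsKraus (Ψ : Matrix m m ℂ → Matrix n n ℂ) : Prop :=
  ∃ (r : ℕ) (K : Fin r → Matrix n m ℂ), ∑ i, (K i)ᴴ * K i = 1 ∧ ∀ X, Ψ X = kmap K X

theorem IsKraus.of_fintype {ι : Type*} [Fintype ι] {Ψ : Matrix m m ℂ → Matrix n n ℂ}
    (K : ι → Matrix n m ℂ) (hK : ∑ i, (K i)ᴴ * K i = 1) (h : ∀ X, Ψ X = kmap K X) :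
    IsKraus Ψ := by
  refine ⟨Fintype.card ι, fun i => K ((Fintype.equivFin ι).symm i), ?_, fun X => ?_⟩
  · rw [← hK]
    exact Equiv.sum_comp (Fintype.equivFin ι).symm fun i => (K i)ᴴ * K i
  · rw [h X]
    exact (Equiv.sum_comp (Fintype.equivFin ι).symm fun i => K i * X * (K i)ᴴ).symm

namespace IsKraus
variable {Ψ : Matrix m m ℂ → Matrix n n ℂ}

theorem posSemidef (h : IsKraus Ψ) {X : Matrix m m ℂ} (hX : X.PosSemidef) :
    (Ψ X).PosSemidef := by
  obtain ⟨r, K, -, hΨ⟩ := h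
  rw [hΨ]
  exact kmap_posSemidef K hX

theorem trace_eq (h : IsKraus Ψ) (X : Matrix m m ℂ) : (Ψ X).trace = X.trace := by
  obtain ⟨r, K, hK, hΨ⟩ := h
  rw [hΨ, trace_kmap hK]

theorem smul_sub_posSemidef (h : IsKraus Ψ) {c : ℂ} {X Y : Matrix m m ℂ}
    (hXY : (c • X - Y).PosSemidef) : (c • Ψ X - Ψ Y).PosSemidef := by
  have h1 := h.posSemidef hXY
  obtain ⟨r, K, -, hΨ⟩ := h
  rwa [hΨ, kmap_sub, kmap_smul, ← hΨ, ← hΨ] at h1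

theorem renyiQ_le (h : IsKraus Ψ) {α : ℝ} (hα : 1 < α) {ρ σ : Matrix m m ℂ}
    (hρ : ρ.PosSemidef) (hσ : σ.PosSemidef) (hs : suppSubset ρ σ) :
    renyiQ α (Ψ ρ) (Ψ σ) ≤ renyiQ α ρ σ := by
  obtain ⟨r, K, hK, hΨ⟩ := h
  rw [hΨ, hΨ]
  exact renyiQ_kmap_le hα hK hρ hσ hs

theorem comp {Θ : Matrix n n ℂ → Matrix k k ℂ} (hΘ : IsKraus Θ) (hΨ : IsKraus Ψ) :
    IsKraus fun X => Θ (Ψ X) := by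
  obtain ⟨r, K, hK, h1⟩ := hΨ
  obtain ⟨s, J, hJ, h2⟩ := hΘ
  refine of_fintype (fun p : Fin s × Fin r => J p.1 * K p.2) ?_ fun X => ?_
  · rw [Fintype.sum_prod_type_right, ← hK]
    refine Finset.sum_congr rfl fun i _ => ?_
    calc ∑ j, (J j * K i)ᴴ * (J j * K i) = (K i)ᴴ * (∑ j, (J j)ᴴ * J j) * K i := by
          simp only [Matrix.mul_sum, Matrix.sum_mul, Matrix.conjTranspose_mul, Matrix.mul_assoc]
      _ = (K i)ᴴ * K i := by rw [hJ, Matrix.mul_one]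
  · rw [h2, h1]
    simp only [kmap, Fintype.sum_prod_type, Matrix.mul_sum, Matrix.sum_mul,
      Matrix.conjTranspose_mul, Matrix.mul_assoc]

theorem reindex (e : m ≃ n) : IsKraus fun X : Matrix m m ℂ => Matrix.reindex e e X := by
  have hsub : ∀ X : Matrix m m ℂ, Matrix.reindex e e X =
      (1 : Matrix m m ℂ).submatrix e.symm id * X * ((1 : Matrix m m ℂ).submatrix e.symm id)ᴴ := by
    intro X
    rw [Matrix.conjTranspose_submatrix, Matrix.conjTranspose_one, Matrix.reindex_apply]
    ext i j
    simp [Matrix.mul_apply, Matrix.one_apply]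
  refine of_fintype (fun _ : Unit => (1 : Matrix m m ℂ).submatrix e.symm id) ?_ fun X => ?_
  · rw [Fintype.sum_unique, Matrix.conjTranspose_submatrix, Matrix.conjTranspose_one,
      Matrix.submatrix_mul_equiv, Matrix.one_mul, Matrix.submatrix_id_id]
  · rw [kmap, Fintype.sum_unique, hsub]

theorem lext {R : Type*} [Fintype R] [DecidableEq R] {Φ : Matrix m m ℂ →ₗ[ℂ] Matrix n n ℂ}
    (h : IsKraus Φ) : IsKraus (lext (R := R) Φ) := by
  obtain ⟨r, K, hK, hΦ⟩ := h
  refine ⟨r, fun i => (1 : Matrix R R ℂ) ⊗ₖ K i, ?_, fun X => ?_⟩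
  · simp only [Matrix.conjTranspose_kronecker, Matrix.conjTranspose_one,
      ← Matrix.mul_kronecker_mul, Matrix.one_mul]
    have : ∑ i, (1 : Matrix R R ℂ) ⊗ₖ ((K i)ᴴ * K i) = (1 : Matrix R R ℂ) ⊗ₖ ∑ i, (K i)ᴴ * K i := by
      ext p q
      simp [Matrix.sum_apply, Finset.mul_sum]
    rw [this, hK, Matrix.one_kronecker_one]
  · ext ⟨x, b⟩ ⟨y, b'⟩
    change Φ (Matrix.of fun a a' => X (x, a) (y, a')) b b' = _
    rw [hΦ]
    simp only [kmap, Matrix.sum_apply]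
    refine Finset.sum_congr rfl fun i _ => ?_
    simp [Matrix.mul_apply, Fintype.sum_prod_type, Matrix.kroneckerMap_apply, Matrix.one_apply,
      apply_ite (starRingEnd ℂ)]

theorem kronecker {ω : Matrix n n ℂ} (hω : ω.PosSemidef) (htr : ω.trace = 1) :
    IsKraus fun X : Matrix m m ℂ => X ⊗ₖ ω := by
  obtain ⟨W, rfl⟩ := exists_eq_conjTranspose_mul_self hω
  refine of_fintype (fun r : n => Matrix.of fun (p : m × n) (x : m) =>
    (1 : Matrix m m ℂ) p.1 x * star (W r p.2)) ?_ fun X => ?_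
  · ext x y
    have h1 : ∑ b, ∑ r, star (W r b) * W r b = 1 := by
      simpa [Matrix.trace, Matrix.mul_apply] using htr
    rw [Finset.sum_comm] at h1
    simp only [Matrix.sum_apply, Matrix.mul_apply, Matrix.conjTranspose_apply, Matrix.of_apply,
      Fintype.sum_prod_type, star_mul', star_star]
    have h2 : ∀ i x_1 x_2, star ((1 : Matrix m m ℂ) x_1 x) * W i x_2 *
        ((1 : Matrix m m ℂ) x_1 y * star (W i x_2)) =
        (star ((1 : Matrix m m ℂ) x_1 x) * (1 : Matrix m m ℂ) x_1 y) *
          (star (W i x_2) * W i x_2) := fun _ _ _ => by ring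
    simp only [h2]
    simp only [Matrix.one_apply, apply_ite star, star_one, star_zero, ite_mul, mul_ite, one_mul,
      zero_mul, mul_one, mul_zero, Finset.sum_ite_irrel, Finset.sum_const_zero,
      Finset.sum_ite_eq', Finset.mem_univ, if_true, h1]
    simp only [eq_comm]
  · ext ⟨x, b⟩ ⟨y, b'⟩
    simp only [kmap, Matrix.sum_apply, Matrix.kroneckerMap_apply, Matrix.mul_apply,
      Matrix.conjTranspose_apply, Matrix.of_apply, Finset.mul_sum]
    refine Finset.sum_congr rfl fun r _ => ?_
    simp [Matrix.one_apply, apply_ite (starRingEnd ℂ)]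
    ring

end IsKraus

theorem IsCPTP.isKraus {Φ : Matrix m m ℂ →ₗ[ℂ] Matrix n n ℂ} (h : IsCPTP Φ) : IsKraus Φ := by
  set e := Fintype.equivFin m with he
  set v : Fin (Fintype.card m) × m → ℂ := fun p => if p.1 = e p.2 then 1 else 0 with hv
  have hJ := h.cp _ _ (Matrix.posSemidef_vecMulVec_self_star v)
  obtain ⟨M, hM⟩ := exists_eq_conjTranspose_mul_self hJ
  have hMe : ∀ a a' b b', ∑ j, star (M j (e a, b)) * M j (e a', b') =
      Φ (Matrix.single a a' 1) b b' := by
    intro a a' b b'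
    have h1 := congrFun (congrFun hM (e a, b)) (e a', b')
    rw [Matrix.mul_apply] at h1
    simp only [Matrix.conjTranspose_apply] at h1
    rw [← h1]
    change Φ _ b b' = _
    refine congrArg (fun Y => Φ Y b b') ?_
    ext x x'
    simp [hv, Matrix.vecMulVec_apply, Matrix.single, ite_and, apply_ite (starRingEnd ℂ)]
    simp only [← ite_and, and_comm]
  set K : Fin (Fintype.card m) × n → Matrix n m ℂ := fun j =>
    Matrix.of fun b a => star (M j (e a, b)) with hKdef
  have hΦ : ∀ X, Φ X = kmap K X := by
    intro X
    conv_lhs => rw [Matrix.matrix_eq_sum_single X]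
    ext b b'
    have hs : ∀ a a', Matrix.single a a' (X a a') = X a a' • Matrix.single a a' (1 : ℂ) := by
      intro a a'
      rw [Matrix.smul_single, smul_eq_mul, mul_one]
    simp only [hs, map_sum, _root_.map_smul, Matrix.sum_apply, Matrix.smul_apply, ← hMe, kmap,
      Matrix.mul_apply, hKdef, Matrix.of_apply, Matrix.conjTranspose_apply, star_star,
      smul_eq_mul, Finset.mul_sum, Finset.sum_mul]
    rw [Finset.sum_comm_cycle]
    refine Finset.sum_congr rfl fun j _ => ?_
    rw [Finset.sum_comm]
    refine Finset.sum_congr rfl fun a _ => Finset.sum_congr rfl fun a' _ => ?_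
    ring
  refine IsKraus.of_fintype K ?_ hΦ
  rw [Matrix.ext_iff_trace_mul_right]
  intro X
  have h1 := h.tp X
  rw [hΦ, kmap, Matrix.trace_sum] at h1
  rw [Matrix.one_mul, ← h1, Finset.sum_mul, Matrix.trace_sum]
  refine Finset.sum_congr rfl fun i _ => ?_
  rw [Matrix.mul_assoc, Matrix.trace_mul_comm, Matrix.mul_assoc]

end Kraus

/-! ### The redistribution protocol -/

section Protocol
variable {S L E P A' B' Q : Type*}
  [Fintype S] [DecidableEq S] [Fintype L] [DecidableEq L] [Fintype E] [DecidableEq E]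
  [Fintype P] [DecidableEq P] [Fintype A'] [DecidableEq A'] [Fintype B'] [DecidableEq B']
  [Fintype Q] [DecidableEq Q]

theorem ptA_eq_ptB {m n : Type*} [Fintype m] (M : Matrix (m × n) (m × n) ℂ) :
    ptA M = ptB (M.submatrix Prod.swap Prod.swap) := rfl

theorem ptA_posSemidef {m n : Type*} [Fintype m] [DecidableEq m] [Fintype n] [DecidableEq n]
    {M : Matrix (m × n) (m × n) ℂ} (hM : M.PosSemidef) : (ptA M).PosSemidef := by
  rw [ptA_eq_ptB]
  exact ptB_posSemidef (hM.submatrix _)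

theorem trace_ptA {m n : Type*} [Fintype m] [Fintype n] (M : Matrix (m × n) (m × n) ℂ) :
    (ptA M).trace = M.trace := by
  simp only [ptA, Matrix.trace, Matrix.diag, Matrix.of_apply, Fintype.sum_prod_type]
  rw [Finset.sum_comm]

/-- The state of the reference, Bob and the message after the encoding. -/
def messageState (ξ : Matrix ((S × (E × B')) × (P × Q)) ((S × (E × B')) × (P × Q)) ℂ) :
    Matrix ((S × (E × B')) × Q) ((S × (E × B')) × Q) ℂ :=
  Matrix.of fun x y => ∑ p, ξ (x.1, (p, x.2)) (y.1, (p, y.2))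

theorem messageState_posSemidef
    {ξ : Matrix ((S × (E × B')) × (P × Q)) ((S × (E × B')) × (P × Q)) ℂ} (hξ : ξ.PosSemidef) :
    (messageState ξ).PosSemidef := by
  have : messageState ξ = ptB (ξ.submatrix (fun x : ((S × (E × B')) × Q) × P =>
      (x.1.1, (x.2, x.1.2))) fun x => (x.1.1, (x.2, x.1.2))) := rfl
  rw [this]
  exact ptB_posSemidef (hξ.submatrix _)

theorem trace_messageState (ξ : Matrix ((S × (E × B')) × (P × Q)) ((S × (E × B')) × (P × Q)) ℂ) :
    (messageState ξ).trace = ξ.trace := by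
  simp only [messageState, Matrix.trace, Matrix.diag, Matrix.of_apply]
  simp only [Fintype.sum_prod_type]
  refine Finset.sum_congr rfl fun _ _ => Finset.sum_congr rfl fun _ _ =>
    Finset.sum_congr rfl fun _ _ => ?_
  rw [Finset.sum_comm]

/-- `(S × (E × B')) × Q ≃ S × ((Q × E) × B')`, gathering Bob's registers. -/
def bobEquiv (S E B' Q : Type*) : (S × (E × B')) × Q ≃ S × ((Q × E) × B') where
  toFun x := (x.1.1, ((x.2, x.1.2.1), x.1.2.2))
  invFun y := ((y.1, (y.2.1.2, y.2.2)), y.2.1.1)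
  left_inv _ := rfl
  right_inv _ := rfl

/-- `S × (E × L) ≃ S × (L × E)`. -/
def outEquiv (S L E : Type*) : S × (E × L) ≃ S × (L × E) where
  toFun x := (x.1, (x.2.2, x.2.1))
  invFun y := (y.1, (y.2.2, y.2.1))
  left_inv _ := rfl
  right_inv _ := rfl

/-- The decoder acting with the reference as spectator. -/
def decMap (dec : Matrix ((Q × E) × B') ((Q × E) × B') ℂ →ₗ[ℂ] Matrix (E × L) (E × L) ℂ)
    (X : Matrix ((S × (E × B')) × Q) ((S × (E × B')) × Q) ℂ) :
    Matrix (S × (L × E)) (S × (L × E)) ℂ :=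
  Matrix.reindex (outEquiv S L E) (outEquiv S L E)
    (lext dec (Matrix.reindex (bobEquiv S E B' Q) (bobEquiv S E B' Q) X))

theorem decMap_isKraus
    {dec : Matrix ((Q × E) × B') ((Q × E) × B') ℂ →ₗ[ℂ] Matrix (E × L) (E × L) ℂ}
    (hdec : IsCPTP dec) : IsKraus (decMap (S := S) dec) :=
  (IsKraus.reindex (outEquiv S L E)).comp
    ((hdec.isKraus.lext (R := S)).comp (IsKraus.reindex (bobEquiv S E B' Q)))

theorem decMap_one_kronecker
    (dec : Matrix ((Q × E) × B') ((Q × E) × B') ℂ →ₗ[ℂ] Matrix (E × L) (E × L) ℂ)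
    (σ : Matrix E E ℂ) (ω : Matrix B' B' ℂ) :
    decMap dec (((1 : Matrix S S ℂ) ⊗ₖ (σ ⊗ₖ ω)) ⊗ₖ (1 : Matrix Q Q ℂ)) =
      (1 : Matrix S S ℂ) ⊗ₖ
        ((dec (((1 : Matrix Q Q ℂ) ⊗ₖ σ) ⊗ₖ ω)).submatrix Prod.swap Prod.swap) := by
  ext ⟨s, l, e⟩ ⟨s', l', e'⟩
  have h : (Matrix.of fun x x' : (Q × E) × B' =>
      ((((1 : Matrix S S ℂ) ⊗ₖ (σ ⊗ₖ ω)) ⊗ₖ (1 : Matrix Q Q ℂ))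
        ((s, (x.1.2, x.2)), x.1.1) ((s', (x'.1.2, x'.2)), x'.1.1))) =
      (1 : Matrix S S ℂ) s s' • (((1 : Matrix Q Q ℂ) ⊗ₖ σ) ⊗ₖ ω) := by
    ext x x'
    simp only [Matrix.of_apply, Matrix.kroneckerMap_apply, Matrix.smul_apply, smul_eq_mul]
    ring
  change dec (Matrix.of fun x x' : (Q × E) × B' =>
      ((((1 : Matrix S S ℂ) ⊗ₖ (σ ⊗ₖ ω)) ⊗ₖ (1 : Matrix Q Q ℂ))
        ((s, (x.1.2, x.2)), x.1.1) ((s', (x'.1.2, x'.2)), x'.1.1))) (e, l) (e', l') = _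
  rw [h, _root_.map_smul]
  rfl

theorem ptB_reindex_lext_dec
    (dec : Matrix ((Q × E) × B') ((Q × E) × B') ℂ →ₗ[ℂ] Matrix (E × L) (E × L) ℂ)
    (ξ : Matrix ((S × (E × B')) × (P × Q)) ((S × (E × B')) × (P × Q)) ℂ) :
    ptB (Matrix.reindex (eFin S L E P) (eFin S L E P)
      (lext dec (Matrix.reindex (eDec S E P B' Q) (eDec S E P B' Q) ξ))) =
      decMap dec (messageState ξ) := by
  ext ⟨s, l, e⟩ ⟨s', l', e'⟩
  change ∑ p, dec (Matrix.of fun x x' : (Q × E) × B' =>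
      ξ ((s, (x.1.2, x.2)), (p, x.1.1)) ((s', (x'.1.2, x'.2)), (p, x'.1.1))) (e, l) (e', l') =
    dec (Matrix.of fun x x' : (Q × E) × B' => ∑ p,
      ξ ((s, (x.1.2, x.2)), (p, x.1.1)) ((s', (x'.1.2, x'.2)), (p, x'.1.1))) (e, l) (e', l')
  rw [← Matrix.sum_apply (e, l) (e', l'), ← map_sum]
  refine congrArg (fun Y => dec Y (e, l) (e', l')) ?_
  ext x x'
  simp [Matrix.sum_apply]

theorem ptB_messageState_encode
    {enc : Matrix ((P × L) × A') ((P × L) × A') ℂ →ₗ[ℂ] Matrix (P × Q) (P × Q) ℂ}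
    (henc : IsCPTP enc) (Θ : Matrix ((S × (L × E)) × P) ((S × (L × E)) × P) ℂ)
    (ent : Matrix (A' × B') (A' × B') ℂ) :
    ptB (messageState (lext enc
      (Matrix.reindex (eEnc S L E P A' B') (eEnc S L E P A' B') (Θ ⊗ₖ ent)))) =
      Matrix.reindex (Equiv.prodAssoc S E B') (Equiv.prodAssoc S E B')
        ((traceOut (eSEL S L E) (ptB Θ)) ⊗ₖ (ptA ent)) := by
  ext ⟨s, e, b⟩ ⟨s', e', b'⟩
  have h := henc.tp (Matrix.of fun x x' : (P × L) × A' =>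
    Θ ((s, (x.1.2, e)), x.1.1) ((s', (x'.1.2, e')), x'.1.1) * ent (x.2, b) (x'.2, b'))
  simp only [Matrix.trace, Matrix.diag, Fintype.sum_prod_type] at h
  rw [Finset.sum_comm] at h
  refine h.trans ?_
  change _ = (∑ l, ∑ p, Θ ((s, (l, e)), p) ((s', (l, e')), p)) * ∑ a, ent (a, b) (a, b')
  simp only [Matrix.of_apply]
  rw [Finset.sum_comm]
  simp only [← Finset.mul_sum, ← Finset.sum_mul]

/-- Chain rule for the trace functional along a redistribution protocol, with explicit
support inclusion for the resulting reference state. -/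
theorem exists_renyiQ_decode_le {α : ℝ} (hα : 1 < α)
    {dec : Matrix ((Q × E) × B') ((Q × E) × B') ℂ →ₗ[ℂ] Matrix (E × L) (E × L) ℂ}
    (hdec : IsCPTP dec)
    {τ : Matrix ((S × (E × B')) × Q) ((S × (E × B')) × Q) ℂ} (hτ : τ.PosSemidef)
    {R : Matrix (S × E) (S × E) ℂ} (hR : R.PosSemidef) {ω : Matrix B' B' ℂ} (hω : IsState ω)
    (hτR : ptB τ = Matrix.reindex (Equiv.prodAssoc S E B') (Equiv.prodAssoc S E B') (R ⊗ₖ ω))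
    [Nonempty Q] {σ : Matrix E E ℂ} (hσ : IsState σ)
    (hs : suppSubset R ((1 : Matrix S S ℂ) ⊗ₖ σ)) :
    ∃ σ' : Matrix (L × E) (L × E) ℂ, IsState σ' ∧
      suppSubset (decMap dec τ) ((1 : Matrix S S ℂ) ⊗ₖ σ') ∧
      renyiQ α (decMap dec τ) ((1 : Matrix S S ℂ) ⊗ₖ σ') ≤
        (Fintype.card Q : ℝ) ^ (2 * (α - 1)) * renyiQ α R ((1 : Matrix S S ℂ) ⊗ₖ σ) := by
  set N : ℝ := ((Fintype.card Q : ℕ) : ℝ) with hN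
  have hN0 : 0 < N := by rw [hN]; exact_mod_cast Fintype.card_pos
  have hNc : (N : ℂ) ≠ 0 := by exact_mod_cast hN0.ne'
  have hD := decMap_isKraus (S := S) hdec
  set κ := (((1 : Matrix Q Q ℂ) ⊗ₖ σ) ⊗ₖ ω) with hκ
  have hκp : κ.PosSemidef := (Matrix.PosSemidef.one.kronecker hσ.1).kronecker hω.1
  have hκt : κ.trace = N := by
    rw [hκ, Matrix.trace_kronecker, Matrix.trace_kronecker, hσ.2, hω.2, Matrix.trace_one, hN]
    simp
  set Y := (dec κ).submatrix Prod.swap Prod.swap with hY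
  have hYp : Y.PosSemidef := (hdec.isKraus.posSemidef hκp).submatrix _
  have hYt : Y.trace = N := by
    rw [← hκt, ← hdec.tp]
    exact Equiv.sum_comp (Equiv.prodComm L E) fun x => dec κ x x
  set σ' := ((N⁻¹ : ℝ) : ℂ) • Y with hσ'
  have hσ's : IsState σ' := by
    refine ⟨hYp.smul (by exact_mod_cast (inv_pos.2 hN0).le), ?_⟩
    rw [hσ', Matrix.trace_smul, hYt, smul_eq_mul, Complex.ofReal_inv, inv_mul_cancel₀ hNc]
  have hYσ : (1 : Matrix S S ℂ) ⊗ₖ Y = (N : ℂ) • ((1 : Matrix S S ℂ) ⊗ₖ σ') := by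
    rw [hσ', Matrix.kronecker_smul, smul_smul, Complex.ofReal_inv, mul_inv_cancel₀ hNc, one_smul]
  have hKr : IsKraus fun X : Matrix (S × E) (S × E) ℂ =>
      Matrix.reindex (Equiv.prodAssoc S E B') (Equiv.prodAssoc S E B') (X ⊗ₖ ω) :=
    (IsKraus.reindex (Equiv.prodAssoc S E B')).comp (IsKraus.kronecker hω.1 hω.2)
  have hassoc : Matrix.reindex (Equiv.prodAssoc S E B') (Equiv.prodAssoc S E B')
      (((1 : Matrix S S ℂ) ⊗ₖ σ) ⊗ₖ ω) = (1 : Matrix S S ℂ) ⊗ₖ (σ ⊗ₖ ω) :=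
    Matrix.kronecker_assoc _ _ _
  have h1σ : ((1 : Matrix S S ℂ) ⊗ₖ σ).PosSemidef := Matrix.PosSemidef.one.kronecker hσ.1
  have h1σω : ((1 : Matrix S S ℂ) ⊗ₖ (σ ⊗ₖ ω)).PosSemidef :=
    Matrix.PosSemidef.one.kronecker (hσ.1.kronecker hω.1)
  have h1σω1 : (((1 : Matrix S S ℂ) ⊗ₖ (σ ⊗ₖ ω)) ⊗ₖ (1 : Matrix Q Q ℂ)).PosSemidef :=
    h1σω.kronecker Matrix.PosSemidef.one
  have h1σ' : ((1 : Matrix S S ℂ) ⊗ₖ σ').PosSemidef := Matrix.PosSemidef.one.kronecker hσ's.1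
  obtain ⟨c, hc, hle⟩ := exists_le_of_suppSubset hR h1σ hs
  have hle1 := hKr.smul_sub_posSemidef hle
  simp only [hassoc] at hle1
  rw [← hτR] at hle1
  have hle2 : (((N * c : ℝ) : ℂ) • (((1 : Matrix S S ℂ) ⊗ₖ (σ ⊗ₖ ω)) ⊗ₖ (1 : Matrix Q Q ℂ)) -
      τ).PosSemidef := by
    have h1 := card_smul_ptB_kronecker_one_sub_posSemidef hτ
    have h2 := (hle1.kronecker (Matrix.PosSemidef.one (n := Q))).smul
      (a := (N : ℂ)) (by exact_mod_cast hN0.le)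
    have h3 : ∀ X Y : Matrix (S × (E × B')) (S × (E × B')) ℂ,
        (X - Y) ⊗ₖ (1 : Matrix Q Q ℂ) = X ⊗ₖ (1 : Matrix Q Q ℂ) - Y ⊗ₖ (1 : Matrix Q Q ℂ) :=
      fun X Y => by ext; simp [sub_mul]
    have h4 := h2.add h1
    rwa [h3, Matrix.smul_kronecker, smul_sub, smul_smul, ← hN, sub_add_sub_cancel,
      ← Complex.ofReal_mul] at h4
  have hle3 := hD.smul_sub_posSemidef hle2
  rw [decMap_one_kronecker, hYσ, smul_smul, ← Complex.ofReal_mul] at hle3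
  have hdτ := hD.posSemidef hτ
  have hs' : suppSubset (decMap dec τ) ((1 : Matrix S S ℂ) ⊗ₖ σ') := suppSubset_of_le hdτ hle3
  refine ⟨σ', hσ's, hs', ?_⟩
  have q1 : renyiQ α (ptB τ) ((1 : Matrix S S ℂ) ⊗ₖ (σ ⊗ₖ ω)) ≤
      renyiQ α R ((1 : Matrix S S ℂ) ⊗ₖ σ) := by
    have := hKr.renyiQ_le hα hR h1σ hs
    simp only [hassoc] at this
    rwa [← hτR] at this
  have q2 := renyiQ_kronecker_one_le hα hτ h1σω
  have q3 := hD.renyiQ_le hα hτ h1σω1 (suppSubset_of_le hτ hle2)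
  rw [decMap_one_kronecker, hYσ, renyiQ_smul hα hdτ h1σ' hN0] at q3
  have e1 : N ^ (α - 1) * N ^ (1 - α) = 1 := by
    rw [← Real.rpow_add hN0]; norm_num
  calc renyiQ α (decMap dec τ) ((1 : Matrix S S ℂ) ⊗ₖ σ')
      = N ^ (α - 1) * (N ^ (1 - α) * renyiQ α (decMap dec τ) ((1 : Matrix S S ℂ) ⊗ₖ σ')) := by
        rw [← mul_assoc, e1, one_mul]
    _ ≤ N ^ (α - 1) * (N ^ (α - 1) * renyiQ α R ((1 : Matrix S S ℂ) ⊗ₖ σ)) := by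
        have hp : 0 ≤ N ^ (α - 1) := Real.rpow_nonneg hN0.le _
        exact mul_le_mul_of_nonneg_left
          (q3.trans (q2.trans (mul_le_mul_of_nonneg_left q1 hp))) hp
    _ = N ^ (2 * (α - 1)) * renyiQ α R ((1 : Matrix S S ℂ) ⊗ₖ σ) := by
        rw [← mul_assoc, ← Real.rpow_add hN0, two_mul]

theorem DR_eq_of_isState {m : Type*} [Fintype m] [DecidableEq m] {α : ℝ} {ρ σ : Matrix m m ℂ}
    (hρ : IsState ρ) : DR α ρ σ = (α - 1)⁻¹ * Real.logb 2 (renyiQ α ρ σ) := by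
  rw [DR, hρ.2, Complex.one_re, div_one, renyiQ]

theorem DR_le_add_of_renyiQ_le {m n : Type*} [Fintype m] [DecidableEq m] [Fintype n]
    [DecidableEq n] {α : ℝ} (hα : 1 < α) {ρ σ : Matrix m m ℂ} {ρ' σ' : Matrix n n ℂ}
    (hρ : IsState ρ) (hρ' : IsState ρ') (hσ : σ.PosSemidef) (hs : suppSubset ρ σ) {N : ℝ}
    (hN : 0 < N) (h : renyiQ α ρ σ ≤ N ^ (2 * (α - 1)) * renyiQ α ρ' σ') :
    DR α ρ σ ≤ DR α ρ' σ' + 2 * Real.logb 2 N := by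
  have hne : ρ ≠ 0 := by
    rintro rfl
    simpa using hρ.2
  have hpos := renyiQ_pos hα hρ.1 hσ hs hne
  have hNp : 0 < N ^ (2 * (α - 1)) := Real.rpow_pos_of_pos hN _
  have hpos' : 0 < renyiQ α ρ' σ' := by
    by_contra hc
    exact absurd (hpos.trans_le h) (not_lt.2 (mul_nonpos_of_nonneg_of_nonpos hNp.le (not_lt.1 hc)))
  have hlog := Real.logb_le_logb_of_le (b := 2) (by norm_num) hpos h
  rw [Real.logb_mul hNp.ne' hpos'.ne', Real.logb_rpow_eq_mul_logb_of_pos hN] at hlog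
  rw [DR_eq_of_isState hρ, DR_eq_of_isState hρ']
  have hα1 : 0 < α - 1 := by linarith
  calc _ ≤ (α - 1)⁻¹ * (2 * (α - 1) * Real.logb 2 N + Real.logb 2 (renyiQ α ρ' σ')) := by
        gcongr
    _ = _ := by field_simp; ring

theorem HUp_sub_le {R : Matrix (S × E) (S × E) ℂ}
    {T : Matrix (S × (L × E)) (S × (L × E)) ℂ} {α c : ℝ}
    (h : ∀ σ : Matrix E E ℂ, IsState σ → ∃ σ' : Matrix (L × E) (L × E) ℂ, IsState σ' ∧
      D α T ((1 : Matrix S S ℂ) ⊗ₖ σ') ≤ D α R ((1 : Matrix S S ℂ) ⊗ₖ σ) + (c : EReal)) :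
    HUp α R - (c : EReal) ≤ HUp α T := by
  unfold HUp
  rw [← EReal.neg_add (by simp) (by simp), EReal.neg_le_neg_iff]
  rw [← EReal.sub_le_iff_le_add (by simp) (by simp)]
  refine le_sInf ?_
  rintro _ ⟨σ, hσ, rfl⟩
  obtain ⟨σ', hσ', hle⟩ := h σ hσ
  rw [EReal.sub_le_iff_le_add (by simp) (by simp)]
  refine le_trans ?_ hle
  exact sInf_le ⟨σ', hσ', rfl⟩

end Protocol

theorem renyi_chain_rule_from_state_redistribution
    {S L E P A' B' Q : Type*}
    [Fintype S] [DecidableEq S] [Fintype L] [DecidableEq L] [Fintype E] [DecidableEq E]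
    [Fintype P] [DecidableEq P] [Fintype A'] [DecidableEq A'] [Fintype B'] [DecidableEq B']
    [Fintype Q] [DecidableEq Q]
    (ρ : Matrix (S × (L × E)) (S × (L × E)) ℂ) (hρ : IsState ρ)
    (ψ : ((S × (L × E)) × P) → ℂ)
    (hψ : traceOut (Equiv.refl ((S × (L × E)) × P)) (pureState ψ) = ρ)
    (ent : Matrix (A' × B') (A' × B') ℂ) (hent : IsState ent)
    (enc : Matrix ((P × L) × A') ((P × L) × A') ℂ →ₗ[ℂ] Matrix (P × Q) (P × Q) ℂ)
    (henc : IsCPTP enc)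
    (dec : Matrix ((Q × E) × B') ((Q × E) × B') ℂ →ₗ[ℂ] Matrix (E × L) (E × L) ℂ)
    (hdec : IsCPTP dec)
    (δ : ℝ) (hδ : 0 ≤ δ)
    (hprot : pDist
      ((Matrix.reindex (eFin S L E P) (eFin S L E P))
        ((lext dec)
          ((Matrix.reindex (eDec S E P B' Q) (eDec S E P B' Q))
            ((lext enc)
              ((Matrix.reindex (eEnc S L E P A' B') (eEnc S L E P A' B'))
                ((pureState ψ) ⊗ₖ ent))))))
      (pureState ψ) ≤ δ)
    (α : ℝ) (hα : 1 < α) :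
    HUpEps α δ ρ ≥
      HUp α (traceOut (eSEL S L E) ρ)
        - ((2 * Real.logb 2 (Fintype.card Q) : ℝ) : EReal) := by
  set Θ : Matrix ((S × (L × E)) × P) ((S × (L × E)) × P) ℂ := pureState ψ with hΘ
  have hΘp : Θ.PosSemidef := Matrix.posSemidef_vecMulVec_self_star ψ
  have hΘρ : ptB Θ = ρ := hψ
  have hΘt : Θ.trace = 1 := by rw [← trace_ptB, hΘρ, hρ.2]
  have hK := (henc.isKraus.lext (R := S × (E × B'))).comp
    (IsKraus.reindex (eEnc S L E P A' B'))
  set ξ := lext enc (Matrix.reindex (eEnc S L E P A' B') (eEnc S L E P A' B') (Θ ⊗ₖ ent)) with hξ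
  have hξp : ξ.PosSemidef := hK.posSemidef (hΘp.kronecker hent.1)
  have hξt : ξ.trace = 1 := by
    refine (hK.trace_eq (Θ ⊗ₖ ent)).trans ?_
    rw [Matrix.trace_kronecker, hΘt, hent.2, one_mul]
  set τ := messageState ξ with hτ
  have hτp : τ.PosSemidef := messageState_posSemidef hξp
  have hτt : τ.trace = 1 := (trace_messageState ξ).trans hξt
  have : Nonempty Q := by
    by_contra hQ
    rw [not_nonempty_iff] at hQ
    simp [Matrix.trace] at hτt
  set R := traceOut (eSEL S L E) ρ with hR
  have hR' : R = ptB (ρ.submatrix (eSEL S L E).symm (eSEL S L E).symm) := rfl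
  have hRs : IsState R := by
    refine ⟨hR' ▸ ptB_posSemidef (hρ.1.submatrix _), ?_⟩
    rw [hR', trace_ptB, ← hρ.2]
    exact Equiv.sum_comp (eSEL S L E).symm fun x => ρ x x
  have hω : IsState (ptA ent) := ⟨ptA_posSemidef hent.1, (trace_ptA ent).trans hent.2⟩
  have hτR : ptB τ = Matrix.reindex (Equiv.prodAssoc S E B') (Equiv.prodAssoc S E B')
      (R ⊗ₖ ptA ent) := by
    rw [hτ, hξ, ptB_messageState_encode henc, hΘρ]
  have hDK := decMap_isKraus (S := S) hdec
  have hout : IsState (decMap (S := S) dec τ) :=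
    ⟨hDK.posSemidef hτp, (hDK.trace_eq τ).trans hτt⟩
  have hfin := ((IsKraus.reindex (eFin S L E P)).comp
    ((hdec.isKraus.lext (R := S × P)).comp (IsKraus.reindex (eDec S E P B' Q)))).posSemidef hξp
  have hdist : pDist (decMap (S := S) dec τ) ρ ≤ δ := by
    refine le_trans ?_ hprot
    have h := pDist_ptB_le hfin hΘp
    rw [hΘρ] at h
    rwa [hτ, ← ptB_reindex_lext_dec]
  have hmem : HUp α (decMap (S := S) dec τ) ≤ HUpEps α δ ρ :=
    le_sSup ⟨_, ⟨hout.1, by rw [hout.2]; simp⟩, hdist, rfl⟩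
  refine le_trans (HUp_sub_le fun σ hσ => ?_) hmem
  have hN0 : (0 : ℝ) < Fintype.card Q := by exact_mod_cast Fintype.card_pos
  by_cases hs : suppSubset R ((1 : Matrix S S ℂ) ⊗ₖ σ)
  · obtain ⟨σ', hσ', hs', hle⟩ := exists_renyiQ_decode_le hα hdec hτp hRs.1 hω hτR hσ hs
    refine ⟨σ', hσ', ?_⟩
    rw [D, D, if_pos (Or.inr hs'), if_pos (Or.inr hs), ← EReal.coe_add, EReal.coe_le_coe_iff]
    exact DR_le_add_of_renyiQ_le hα hout hRs (Matrix.PosSemidef.one.kronecker hσ'.1) hs' hN0 hle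
  · refine ⟨ptA ρ, ⟨ptA_posSemidef hρ.1, (trace_ptA ρ).trans hρ.2⟩, ?_⟩
    have hD : ¬ ((α < 1 ∧ ¬ (R * ((1 : Matrix S S ℂ) ⊗ₖ σ) = 0 ∧
        ((1 : Matrix S S ℂ) ⊗ₖ σ) * R = 0)) ∨ suppSubset R ((1 : Matrix S S ℂ) ⊗ₖ σ)) :=
      not_or.2 ⟨fun h => absurd h.1 (not_lt.2 hα.le), hs⟩
    conv_rhs => rw [D, if_neg hD, EReal.top_add_coe]
    exact le_top

end QITLeak
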